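/- Let Ω ∈ K^{n×ℓ} and Ψ ∈ K^{d×k} be independent random embeddings that have full column rank almost surely, with ℓ + α_K < k, where Ω satisfies UΩ ~ Ω for each unitary U ∈ K^{n×n} and Ψ is either a Gaussian embedding (put γ = 1) or a random orthonormal embedding (put γ = (d − k)/(d − ℓ)). Then for any matrix A ∈ K^{d×n} with r := rank(A) ≥ k, E‖A − A⟨Ω,Ψ⟩‖_F² ≤ (1 + γ · ℓ/(k − ℓ − α_K)) · min over natural numbers q with q < ℓ − α_K of ((r − ℓ)/(r − q)) · (1 + q/(ℓ − q − α_K)) · ‖A − [A]_q‖_F². -/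

import Mathlib

open MeasureTheory ProbabilityTheory Matrix Filter
open scoped ENNReal Topology ComplexOrder

noncomputable section

open Classical in
/-- `α_K`: 1 if `K = ℝ`, 0 if `K = ℂ`. -/
def alphaK (K : Type*) [RCLike K] : ℝ := if (RCLike.I : K) = 0 then 1 else 0

/-- Squared Frobenius norm of a matrix. -/
def frobSq {K : Type*} [RCLike K] {m n : Type*} [Fintype m] [Fintype n]
    (A : Matrix m n K) : ℝ := ∑ i, ∑ j, ‖A i j‖ ^ 2

/-- The four Penrose conditions characterizing the Moore–Penrose pseudoinverse. -/
def IsMoorePenrose {K : Type*} [RCLike K] {m n : Type*} [Fintype m] [Fintype n]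
    (A : Matrix m n K) (X : Matrix n m K) : Prop :=
  A * X * A = A ∧ X * A * X = X ∧ (A * X)ᴴ = A * X ∧ (X * A)ᴴ = X * A

instance matrixMeasurableSpace {m n α : Type*} [MeasurableSpace α] :
    MeasurableSpace (Matrix m n α) :=
  inferInstanceAs (MeasurableSpace (m → n → α))

/-- `M` is rotation-invariant: `U * M` has the same distribution as `M` for every unitary `U`. -/
def RotationInvariant {K : Type*} [RCLike K] [MeasurableSpace K]
    {Y : Type*} [MeasurableSpace Y] (μ : Measure Y) {n ℓ : ℕ}
    (M : Y → Matrix (Fin n) (Fin ℓ) K) : Prop :=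
  ∀ U : Matrix (Fin n) (Fin n) K, U ∈ Matrix.unitaryGroup (Fin n) K →
    Measure.map (fun ω => U * M ω) μ = Measure.map M μ

/-- `M` is a random orthonormal embedding: rotation-invariant, with orthonormal
columns almost surely. -/
def IsRandomOrthonormal {K : Type*} [RCLike K] [MeasurableSpace K]
    {Y : Type*} [MeasurableSpace Y] (μ : Measure Y) {n ℓ : ℕ}
    (M : Y → Matrix (Fin n) (Fin ℓ) K) : Prop :=
  Measurable M ∧ RotationInvariant μ M ∧ ∀ᵐ ω ∂μ, (M ω)ᴴ * M ω = 1

open Classical in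
/-- A standard normal sample in `K` built from two independent real coordinates:
for `K = ℝ` it is the first coordinate, for `K = ℂ` it is `(g₁ + i g₂)/√2`. -/
def stdGaussianEntry (K : Type*) [RCLike K] (v : Bool → ℝ) : K :=
  if (RCLike.I : K) = 0 then (v false : K)
  else ((v false : K) + RCLike.I * (v true : K)) / (Real.sqrt 2 : K)

/-- The distribution of an `r × c` matrix with independent standard normal
`N_K(0,1)` entries. -/
def gaussianMatrix (K : Type*) [RCLike K] [MeasurableSpace K] (r c : ℕ) :
    Measure (Matrix (Fin r) (Fin c) K) :=
  Measure.map
    (fun g : Fin r → Fin c → Bool → ℝ => Matrix.of fun i j => stdGaussianEntry K (g i j))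
    (Measure.pi fun _ : Fin r => Measure.pi fun _ : Fin c =>
      Measure.pi fun _ : Bool => gaussianReal 0 1)

/-- `M` is a Gaussian embedding: a random matrix with iid standard normal `N_K(0,1)` entries. -/
def IsGaussianEmbedding {K : Type*} [RCLike K] [MeasurableSpace K]
    {Y : Type*} [MeasurableSpace Y] (μ : Measure Y) {n ℓ : ℕ}
    (M : Y → Matrix (Fin n) (Fin ℓ) K) : Prop :=
  Measurable M ∧ Measure.map M μ = gaussianMatrix K n ℓ

/-- `Aq` is a best rank-`q` approximation of `A` in Frobenius norm
(equivalently, a matrix obtained from a `q`-truncated SVD of `A`). -/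
def IsBestRankApprox {K : Type*} [RCLike K] {m n : Type*} [Fintype m] [Fintype n]
    [DecidableEq n] (q : ℕ) (A Aq : Matrix m n K) : Prop :=
  Aq.rank ≤ q ∧ ∀ B : Matrix m n K, B.rank ≤ q → frobSq (A - Aq) ≤ frobSq (A - B)

set_option linter.unusedSectionVars false
set_option linter.unusedVariables false


noncomputable section

/-- The standard Gaussian law on `K`. -/
def gK (K : Type*) [RCLike K] [MeasurableSpace K] : Measure K :=
  Measure.map (stdGaussianEntry K) (Measure.pi fun _ : Bool => gaussianReal 0 1)

/-- Standard Gaussian vector. -/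
def gvec (K : Type*) [RCLike K] [MeasurableSpace K] (ι : Type*) [Fintype ι] : Measure (ι → K) :=
  Measure.pi fun _ => gK K

section gauss
variable {K : Type*} [RCLike K] [MeasurableSpace K] [BorelSpace K]

lemma continuous_stdGaussianEntry : Continuous (stdGaussianEntry K) := by
  unfold stdGaussianEntry
  split_ifs <;> fun_prop

lemma measurable_stdGaussianEntry : Measurable (stdGaussianEntry K) :=
  continuous_stdGaussianEntry.measurable

instance : IsProbabilityMeasure (gK K) :=
  Measure.isProbabilityMeasure_map measurable_stdGaussianEntry.aemeasurable

instance {ι : Type*} [Fintype ι] : IsProbabilityMeasure (gvec K ι) := by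
  unfold gvec; infer_instance

/-- variance constant -/
def cK (K : Type*) [RCLike K] : ℝ := (1 + alphaK K) / 4

lemma dual_repr (L : K →L[ℝ] ℝ) : ∃ a : K, ∀ z, L z = RCLike.re (star a * z) := by
  refine ⟨(L 1 : K) + RCLike.I * (L RCLike.I : K), fun z => ?_⟩
  have h : z = (RCLike.re z) • (1 : K) + (RCLike.im z) • (RCLike.I : K) := by
    rw [RCLike.real_smul_eq_coe_mul, RCLike.real_smul_eq_coe_mul, mul_one, RCLike.re_add_im]
  conv_lhs => rw [h]
  rw [map_add, map_smul, map_smul]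
  rcases RCLike.I_mul_I_ax (K := K) with h | h
  · simp [h]; ring
  · have h2 : RCLike.im (RCLike.I : K) = 1 := by
      by_contra hh
      have := RCLike.I_im' (K := K)
      apply hh
      have h3 := congrArg RCLike.re h
      simp at h3
      nlinarith [RCLike.mul_im_I_ax (RCLike.I : K)]
    simp [h2]; ring

lemma charFunDual_gaussianReal (L : ℝ →L[ℝ] ℝ) :
    charFunDual (gaussianReal 0 1) L = Complex.exp (-((L 1 : ℝ) ^ 2 / 2 : ℝ)) := by
  have : charFunDual (gaussianReal 0 1) L = charFun (gaussianReal 0 1) (L 1) := by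
    rw [charFunDual_apply, charFun_apply_real]
    congr 1; ext v
    have : L v = L 1 * v := by
      have := L.map_smul v 1
      simp at this; rw [this]; ring
    rw [this]; push_cast; ring_nf
  rw [this, charFun_gaussianReal]
  congr 1; push_cast; simp

lemma charFunDual_gK (L : K →L[ℝ] ℝ) (a : K) (h : ∀ z, L z = RCLike.re (star a * z)) :
    charFunDual (gK K) L = Complex.exp (-(cK K * ‖a‖ ^ 2 : ℝ)) := by
  let Λ : (Bool → ℝ) →ₗ[ℝ] K :=
    { toFun := stdGaussianEntry K
      map_add' := by
        intro x y; unfold stdGaussianEntry; split_ifs <;> simp <;> ring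
      map_smul' := by
        intro c x; unfold stdGaussianEntry
        split_ifs <;> simp [RCLike.real_smul_eq_coe_mul] ; ring }
  have hΛ : gK K = Measure.map (Λ.toContinuousLinearMap) (Measure.pi fun _ : Bool => gaussianReal 0 1) := rfl
  rw [hΛ, charFunDual_map, charFunDual_pi]
  simp_rw [charFunDual_gaussianReal]
  rw [← Complex.exp_sum]
  congr 1
  have hn : ‖a‖ ^ 2 = (RCLike.re a) ^ 2 + (RCLike.im a) ^ 2 := by
    rw [RCLike.norm_sq_eq_def]; ring
  rw [hn]
  simp only [Fintype.sum_bool]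
  have e1 : ∀ b, (((Λ.toContinuousLinearMap : (Bool → ℝ) →L[ℝ] K)).comp
     (ContinuousLinearMap.single ℝ (fun _ : Bool => ℝ) b)) 1 = stdGaussianEntry K (Pi.single b 1) := by
    intro b; rfl
  simp only [ContinuousLinearMap.comp_assoc]
  rw [ContinuousLinearMap.comp_apply L, ContinuousLinearMap.comp_apply L, e1, e1, h, h]
  by_cases hI : (RCLike.I : K) = 0
  · have him : RCLike.im a = 0 := by
      have := RCLike.mul_im_I_ax a; rw [hI] at this; simpa using this.symm
    simp [stdGaussianEntry, hI, cK, alphaK, him]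
    norm_cast; ring
  · have h2 : RCLike.im (RCLike.I : K) = 1 := by
      have h3 := congrArg RCLike.re ((RCLike.I_mul_I_ax (K := K)).resolve_left hI)
      simp at h3
      nlinarith [RCLike.mul_im_I_ax (RCLike.I : K)]
    have hs : (Real.sqrt 2) ^ 2 = 2 := Real.sq_sqrt (by norm_num)
    have hs0 : (Real.sqrt 2) ≠ 0 := by positivity
    simp only [stdGaussianEntry, hI, cK, alphaK, if_false]
    have q : ∀ w : K, RCLike.re (star a * (w / (Real.sqrt 2 : K))) = RCLike.re (star a * w) / Real.sqrt 2 := by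
      intro w
      rw [← mul_div_assoc, RCLike.div_re_ofReal]
    rw [q, q]
    simp only [div_pow, hs]
    simp [h2]
    ring

end gauss
end


noncomputable section
section gauss
variable {K : Type*} [RCLike K] [MeasurableSpace K] [BorelSpace K]

lemma stdGaussianEntry_norm_sq (v : Bool → ℝ) : ‖stdGaussianEntry K v‖ ^ 2 =
    if (RCLike.I : K) = 0 then (v false) ^ 2 else ((v false) ^ 2 + (v true) ^ 2) / 2 := by
  unfold stdGaussianEntry
  split_ifs with hI
  · rw [RCLike.norm_ofReal, sq_abs]
  · have h2 : RCLike.im (RCLike.I : K) = 1 := by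
      have h3 := congrArg RCLike.re ((RCLike.I_mul_I_ax (K := K)).resolve_left hI)
      simp at h3
      nlinarith [RCLike.mul_im_I_ax (RCLike.I : K)]
    rw [norm_div, div_pow, RCLike.norm_ofReal, sq_abs, Real.sq_sqrt (by norm_num)]
    congr 1
    rw [RCLike.norm_sq_eq_def]
    simp [h2]; ring

lemma integral_exp_gaussianReal (t : ℝ) (ht : 0 ≤ t) :
    ∫ x, Real.exp (-t * x ^ 2) ∂(gaussianReal 0 1) = (1 + 2 * t) ^ (-(1/2) : ℝ) := by
  rw [integral_gaussianReal_eq_integral_smul (by simp)]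
  simp only [gaussianPDFReal, smul_eq_mul]
  have : ∀ x : ℝ, (√(2 * Real.pi * (1 : NNReal)))⁻¹ * Real.exp (-(x - 0) ^ 2 / (2 * (1 : NNReal))) * Real.exp (-t * x ^ 2)
      = (√(2 * Real.pi))⁻¹ * Real.exp (-(t + 1/2) * x ^ 2) := by
    intro x
    rw [mul_assoc, ← Real.exp_add]
    congr 2
    · simp
    · push_cast; ring
  simp_rw [this]
  rw [integral_const_mul, integral_gaussian, Real.rpow_neg (by positivity), ← Real.sqrt_eq_rpow,
    ← Real.sqrt_inv, ← Real.sqrt_mul (by positivity), ← Real.sqrt_inv]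
  congr 1
  have := Real.pi_pos
  field_simp; ring

lemma integral_exp_gK (t : ℝ) (ht : 0 ≤ t) :
    ∫ z, Real.exp (-t * ‖z‖ ^ 2) ∂(gK K) = (1 + (1 + alphaK K) * t) ^ (-(1 / (1 + alphaK K)) : ℝ) := by
  unfold gK
  rw [integral_map measurable_stdGaussianEntry.aemeasurable (by fun_prop)]
  simp_rw [stdGaussianEntry_norm_sq]
  unfold alphaK
  split_ifs with hI
  · have h := integral_fintype_prod_eq_prod (ι := Bool) (𝕜 := ℝ) (E := fun _ => ℝ)
      (fun b x => if b then 1 else Real.exp (-t * x ^ 2)) (μ := fun _ => gaussianReal 0 1)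
    simp only [Fintype.prod_bool, if_true, one_mul, Bool.false_eq_true, if_false] at h
    rw [h, integral_exp_gaussianReal t ht]
    norm_num
  · have h := integral_fintype_prod_eq_prod (ι := Bool) (𝕜 := ℝ) (E := fun _ => ℝ)
      (fun b x => Real.exp (-(t/2) * x ^ 2)) (μ := fun _ => gaussianReal 0 1)
    simp only [Fintype.prod_bool] at h
    rw [integral_exp_gaussianReal _ (by positivity), ← Real.rpow_add (by positivity)] at h
    norm_num at h ⊢
    rw [mul_div_cancel₀ t (two_ne_zero)] at h
    rw [← h]
    congr 1; ext v
    rw [← Real.exp_add]; congr 1; ring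

lemma integral_exp_gvec {ι : Type*} [Fintype ι] (t : ℝ) (ht : 0 ≤ t) :
    ∫ g, Real.exp (-t * ∑ i, ‖g i‖ ^ 2) ∂(gvec K ι) =
      (1 + (1 + alphaK K) * t) ^ (-(Fintype.card ι / (1 + alphaK K)) : ℝ) := by
  have hα : 0 ≤ alphaK K := by unfold alphaK; split_ifs <;> norm_num
  have h := integral_fintype_prod_eq_prod (ι := ι) (𝕜 := ℝ) (E := fun _ => K)
      (fun b x => Real.exp (-t * ‖x‖ ^ 2)) (μ := fun _ => gK K)
  simp_rw [← Real.exp_sum, ← Finset.mul_sum] at h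
  unfold gvec
  rw [h, integral_exp_gK t ht, Finset.prod_const, ← Real.rpow_natCast, ← Real.rpow_mul (by positivity)]
  congr 1
  rw [Finset.card_univ]; ring

lemma lintegral_exp_Ioi (x : ℝ) (hx : 0 ≤ x) :
    ∫⁻ t in Set.Ioi (0:ℝ), ENNReal.ofReal (Real.exp (-t * x)) = (ENNReal.ofReal x)⁻¹ := by
  rcases hx.eq_or_lt with rfl | hx
  · simp
  · have hi : IntegrableOn (fun t => Real.exp (-t * x)) (Set.Ioi (0:ℝ)) := by
      have := integrableOn_exp_mul_Ioi (a := -x) (by linarith) 0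
      refine this.congr_fun (fun t _ => ?_) measurableSet_Ioi
      simp only; congr 1; ring
    rw [← ofReal_integral_eq_lintegral_ofReal hi (ae_of_all _ fun t => (Real.exp_pos _).le)]
    have : ∀ t, Real.exp (-t * x) = Real.exp ((-x) * t) := fun t => by congr 1; ring
    simp_rw [this]
    rw [integral_exp_mul_Ioi (by linarith), ← ENNReal.ofReal_inv_of_pos hx]
    congr 1; simp

lemma alphaK_nonneg : 0 ≤ alphaK K := by unfold alphaK; split_ifs <;> norm_num

lemma lintegral_inv_gvec {ι : Type*} [Fintype ι] (h : 1 + alphaK K < Fintype.card ι) :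
    ∫⁻ g, (ENNReal.ofReal (∑ i, ‖g i‖ ^ 2))⁻¹ ∂(gvec K ι) ≤
      ENNReal.ofReal (1 / (Fintype.card ι - 1 - alphaK K)) := by
  have hα := alphaK_nonneg (K := K)
  set β := 1 + alphaK K with hβ
  have hβ0 : 0 < β := by linarith
  set m : ℝ := (Fintype.card ι : ℝ) with hm
  have e1 : ∀ g : ι → K, (ENNReal.ofReal (∑ i, ‖g i‖ ^ 2))⁻¹ =
     ∫⁻ t in Set.Ioi (0:ℝ), ENNReal.ofReal (Real.exp (-t * ∑ i, ‖g i‖ ^ 2)) := fun g =>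
     (lintegral_exp_Ioi _ (by positivity)).symm
  simp_rw [e1]
  rw [lintegral_lintegral_swap (by fun_prop)]
  have e2 : ∀ t ∈ Set.Ioi (0:ℝ), ∫⁻ g, ENNReal.ofReal (Real.exp (-t * ∑ i, ‖g i‖ ^ 2)) ∂(gvec K ι) =
      ENNReal.ofReal ((1 + β * t) ^ (-(m / β))) := by
    intro t ht
    have ht : 0 < t := ht
    rw [← integral_exp_gvec t ht.le, ofReal_integral_eq_lintegral_ofReal]
    · refine Integrable.of_bound (C := 1) (Measurable.aestronglyMeasurable (by fun_prop)) (ae_of_all _ fun g => ?_)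
      rw [Real.norm_eq_abs, abs_of_pos (Real.exp_pos _), Real.exp_le_one_iff]
      have : 0 ≤ ∑ i, ‖g i‖ ^ 2 := by positivity
      nlinarith
    · exact ae_of_all _ fun t => (Real.exp_pos _).le
  rw [setLIntegral_congr_fun measurableSet_Ioi e2]
  have hd : ∀ t ∈ Set.Ici (0:ℝ), HasDerivAt (fun t => -(1 + β * t) ^ (1 - m / β) / (m - β))
      ((1 + β * t) ^ (-(m / β))) t := by
    intro t ht
    have ht : 0 ≤ t := ht
    have h1 : HasDerivAt (fun t => 1 + β * t) β t := by
      simpa using ((hasDerivAt_id t).const_mul β).const_add 1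
    have h2 := ((h1.rpow_const (p := 1 - m / β) (Or.inl (by positivity))).neg).div_const (m - β)
    have h4 : m - β ≠ 0 := by linarith
    refine HasDerivAt.congr_deriv h2 ?_
    rw [show 1 - m / β - 1 = -(m/β) by ring]
    field_simp; ring
  have hlim : Tendsto (fun t => -(1 + β * t) ^ (1 - m / β) / (m - β)) atTop (𝓝 (-0 / (m - β))) := by
    refine (Tendsto.neg ?_).div_const _
    have h3 : 0 < m / β - 1 := by rw [sub_pos, lt_div_iff₀ hβ0]; linarith
    have := (tendsto_rpow_neg_atTop h3).comp
      (tendsto_atTop_add_const_left atTop 1 (tendsto_id.const_mul_atTop hβ0))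
    refine this.congr fun t => ?_
    simp [neg_sub]
  have hnn : ∀ t ∈ Set.Ioi (0:ℝ), 0 ≤ (1 + β * t) ^ (-(m / β)) := by
    intro t ht
    have ht : 0 < t := ht
    positivity
  have hIntg := integrableOn_Ioi_deriv_of_nonneg' hd hnn hlim
  rw [← ofReal_integral_eq_lintegral_ofReal hIntg
    ((ae_restrict_iff' measurableSet_Ioi).2 (ae_of_all _ hnn)),
    integral_Ioi_of_hasDerivAt_of_nonneg' hd hnn hlim]
  apply ENNReal.ofReal_le_ofReal
  simp [hβ, neg_div]
  rw [sub_sub]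

lemma lintegral_sq_gaussianReal : ∫⁻ x, ENNReal.ofReal (x ^ 2) ∂(gaussianReal 0 1) = 1 := by
  have h := variance_id_gaussianReal (μ := 0) (v := 1)
  have hm := memLp_id_gaussianReal (μ := 0) (v := 1) 2
  rw [variance_of_integral_eq_zero (by fun_prop) (by simp [integral_id_gaussianReal])] at h
  have hs : Integrable (fun x : ℝ => x ^ 2) (gaussianReal 0 1) := hm.integrable_sq
  rw [← ofReal_integral_eq_lintegral_ofReal hs (ae_of_all _ fun x => sq_nonneg x)]
  simp at h ⊢
  exact h

lemma lintegral_sq_gK : ∫⁻ z, ENNReal.ofReal (‖z‖ ^ 2) ∂(gK K) = 1 := by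
  unfold gK
  rw [lintegral_map (by fun_prop) measurable_stdGaussianEntry]
  simp_rw [stdGaussianEntry_norm_sq]
  have h : ∀ b : Bool, ∫⁻ v, ENNReal.ofReal (v b ^ 2) ∂(Measure.pi fun _ : Bool => gaussianReal 0 1) = 1 := by
    intro b
    have := (measurePreserving_eval (fun _ : Bool => gaussianReal 0 1) b).lintegral_comp
      (f := fun x : ℝ => ENNReal.ofReal (x ^ 2)) (by fun_prop)
    rw [← lintegral_sq_gaussianReal, ← this]
  split_ifs with hI
  · exact h false
  · have : ∀ v : Bool → ℝ, ENNReal.ofReal ((v false ^ 2 + v true ^ 2) / 2) =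
       ENNReal.ofReal (2⁻¹) * (ENNReal.ofReal (v false ^ 2) + ENNReal.ofReal (v true ^ 2)) := by
      intro v
      rw [← ENNReal.ofReal_add (by positivity) (by positivity), ← ENNReal.ofReal_mul (by positivity)]
      congr 1; ring
    simp_rw [this]
    rw [lintegral_const_mul _ (by fun_prop), lintegral_add_left (by fun_prop), h, h,
      one_add_one_eq_two, ← ENNReal.ofReal_ofNat, ← ENNReal.ofReal_mul (by positivity)]
    norm_num

end gauss
end


noncomputable section
section gauss
variable {K : Type*} [RCLike K] [MeasurableSpace K] [BorelSpace K]

lemma dual_repr_pi {ι : Type*} [Fintype ι] (L : (ι → K) →L[ℝ] ℝ) :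
    ∃ a : ι → K, ∀ x, L x = ∑ i, RCLike.re (star (a i) * x i) := by
  classical
  choose a ha using fun i => dual_repr (L.comp (ContinuousLinearMap.single ℝ (fun _ : ι => K) i))
  refine ⟨a, fun x => ?_⟩
  rw [← L.sum_comp_single]
  exact Finset.sum_congr rfl fun i _ => ha i (x i)

lemma charFunDual_gvec {ι : Type*} [Fintype ι] (L : (ι → K) →L[ℝ] ℝ) (a : ι → K)
    (h : ∀ x, L x = ∑ i, RCLike.re (star (a i) * x i)) :
    charFunDual (gvec K ι) L = Complex.exp (-(cK K * ∑ i, ‖a i‖ ^ 2 : ℝ)) := by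
  classical
  unfold gvec
  rw [charFunDual_pi]
  have : ∀ i, charFunDual (gK K) (L.comp (ContinuousLinearMap.single ℝ (fun _ : ι => K) i)) =
      Complex.exp (-(cK K * ‖a i‖ ^ 2 : ℝ)) := by
    intro i
    apply charFunDual_gK
    intro z
    rw [ContinuousLinearMap.comp_apply, h]
    rw [Finset.sum_eq_single i]
    · simp
    · intro j _ hj; simp [hj]
    · simp
  simp_rw [this]
  rw [← Complex.exp_sum, Finset.mul_sum]
  congr 1
  push_cast
  rw [Finset.sum_neg_distrib]

/-- Gaussian matrix (rows indexed by `ι`) -/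
def gm (K : Type*) [RCLike K] [MeasurableSpace K] (ι κ : Type*) [Fintype ι] [Fintype κ] :
    Measure (ι → κ → K) := Measure.pi fun _ => gvec K κ

instance {ι κ : Type*} [Fintype ι] [Fintype κ] : IsProbabilityMeasure (gm K ι κ) := by
  unfold gm; infer_instance

lemma dual_repr_gm {ι κ : Type*} [Fintype ι] [Fintype κ] (L : (ι → κ → K) →L[ℝ] ℝ) :
    ∃ a : ι → κ → K, ∀ x, L x = ∑ i, ∑ j, RCLike.re (star (a i j) * x i j) := by
  classical
  choose a ha using fun i => dual_repr_pi (L.comp (ContinuousLinearMap.single ℝ (fun _ : ι => κ → K) i))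
  refine ⟨a, fun x => ?_⟩
  rw [← L.sum_comp_single]
  exact Finset.sum_congr rfl fun i _ => ha i (x i)

lemma charFunDual_gm {ι κ : Type*} [Fintype ι] [Fintype κ] (L : (ι → κ → K) →L[ℝ] ℝ) (a : ι → κ → K)
    (h : ∀ x, L x = ∑ i, ∑ j, RCLike.re (star (a i j) * x i j)) :
    charFunDual (gm K ι κ) L = Complex.exp (-(cK K * ∑ i, ∑ j, ‖a i j‖ ^ 2 : ℝ)) := by
  classical
  unfold gm
  rw [charFunDual_pi]
  have : ∀ i, charFunDual (gvec K κ) (L.comp (ContinuousLinearMap.single ℝ (fun _ : ι => κ → K) i)) =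
      Complex.exp (-(cK K * ∑ j, ‖a i j‖ ^ 2 : ℝ)) := by
    intro i
    apply charFunDual_gvec
    intro z
    rw [ContinuousLinearMap.comp_apply, h]
    rw [Finset.sum_eq_single i]
    · simp
    · intro j _ hj; simp [hj]
    · simp
  simp_rw [this]
  rw [← Complex.exp_sum, Finset.mul_sum]
  congr 1
  push_cast
  rw [Finset.sum_neg_distrib]

lemma star_dotProduct_self' {τ : Type*} [Fintype τ] (b : τ → K) :
    star b ⬝ᵥ b = ((∑ i, ‖b i‖ ^ 2 : ℝ) : K) := by
  simp only [dotProduct, Pi.star_apply]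
  push_cast
  refine Finset.sum_congr rfl fun i _ => ?_
  rw [RCLike.star_def, RCLike.conj_mul]

lemma norm_sq_mulVec_isometry {ι κ : Type*} [Fintype ι] [Fintype κ] [DecidableEq κ]
    (V : Matrix ι κ K) (hV : Vᴴ * V = 1)
    (a : κ → K) : ∑ i, ‖∑ j, V i j * a j‖ ^ 2 = ∑ j, ‖a j‖ ^ 2 := by
  have h : star (V *ᵥ a) ⬝ᵥ (V *ᵥ a) = star a ⬝ᵥ a := by
    rw [star_mulVec, dotProduct_mulVec, vecMul_vecMul, hV, vecMul_one]
  rw [star_dotProduct_self', star_dotProduct_self'] at h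
  exact_mod_cast h

lemma gvec_map {ι κ : Type*} [Fintype ι] [Fintype κ] [DecidableEq κ] (V : Matrix ι κ K) (hV : Vᴴ * V = 1) :
    Measure.map (fun g => Vᴴ *ᵥ g) (gvec K ι) = gvec K κ := by
  let Λ : (ι → K) →L[ℝ] (κ → K) :=
    LinearMap.toContinuousLinearMap ((Matrix.mulVecLin Vᴴ).restrictScalars ℝ)
  have hΛ : Measure.map (fun g => Vᴴ *ᵥ g) (gvec K ι) = Measure.map Λ (gvec K ι) := rfl
  rw [hΛ]
  have : IsProbabilityMeasure (Measure.map Λ (gvec K ι)) :=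
    Measure.isProbabilityMeasure_map (by fun_prop)
  refine Measure.ext_of_charFunDual (funext fun L => ?_)
  obtain ⟨a, ha⟩ := dual_repr_pi L
  rw [charFunDual_map, charFunDual_gvec L a ha,
    charFunDual_gvec _ (fun i => ∑ j, V i j * a j)]
  · rw [norm_sq_mulVec_isometry V hV]
  · intro x
    rw [ContinuousLinearMap.comp_apply, ha]
    have : ∀ j, Λ x j = ∑ i, star (V i j) * x i := fun j => rfl
    simp_rw [this, ← map_sum]
    congr 1
    simp_rw [star_sum, Finset.mul_sum, Finset.sum_mul]
    rw [Finset.sum_comm]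
    refine Finset.sum_congr rfl fun i _ => Finset.sum_congr rfl fun j _ => ?_
    rw [star_mul]; ring

lemma gm_map {ι ι' κ : Type*} [Fintype ι] [Fintype ι'] [Fintype κ] [DecidableEq ι']
    (W : Matrix ι ι' K) (hW : Wᴴ * W = 1) :
    Measure.map (fun (x : ι → κ → K) (j : ι') (s : κ) => ∑ i, star (x i s) * W i j) (gm K ι κ) = gm K ι' κ := by
  let Λ0 : (ι → κ → K) →ₗ[ℝ] (ι' → κ → K) :=
    { toFun := fun (x : ι → κ → K) (j : ι') (s : κ) => ∑ i, star (x i s) * W i j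
      map_add' := by
        intro x y; ext j s
        simp [add_mul, Finset.sum_add_distrib]
      map_smul' := by
        intro c x; ext j s
        simp [Finset.smul_sum, RCLike.real_smul_eq_coe_mul, mul_assoc] }
  let Λ : (ι → κ → K) →L[ℝ] (ι' → κ → K) := LinearMap.toContinuousLinearMap Λ0
  have hΛ : Measure.map (fun (x : ι → κ → K) (j : ι') (s : κ) => ∑ i, star (x i s) * W i j) (gm K ι κ)
    = Measure.map Λ (gm K ι κ) := rfl
  rw [hΛ]
  have : IsProbabilityMeasure (Measure.map Λ (gm K ι κ)) :=
    Measure.isProbabilityMeasure_map (by fun_prop)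
  refine Measure.ext_of_charFunDual (funext fun L => ?_)
  obtain ⟨a, ha⟩ := dual_repr_gm L
  rw [charFunDual_map, charFunDual_gm L a ha,
    charFunDual_gm _ (fun i s => ∑ j, W i j * star (a j s))]
  · congr 4
    rw [Finset.sum_comm]
    conv_rhs => rw [Finset.sum_comm]
    refine Finset.sum_congr rfl fun s _ => ?_
    rw [norm_sq_mulVec_isometry W hW]
    simp
  · intro x
    rw [ContinuousLinearMap.comp_apply, ha]
    have : ∀ j s, Λ x j s = ∑ i, star (x i s) * W i j := fun j s => rfl
    have hre : ∀ z : K, RCLike.re z = RCLike.re (star z) := by intro z; simp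
    simp_rw [this]
    rw [Finset.sum_comm]
    conv_rhs => rw [Finset.sum_comm]
    refine Finset.sum_congr rfl fun s _ => ?_
    rw [← map_sum, ← map_sum, hre]
    congr 1
    simp_rw [star_sum, Finset.mul_sum, Finset.sum_mul, star_sum]
    rw [Finset.sum_comm]
    refine Finset.sum_congr rfl fun i _ => Finset.sum_congr rfl fun j _ => ?_
    simp; ring

lemma gaussianMatrix_eq (r c : ℕ) : gaussianMatrix K r c = (gm K (Fin r) (Fin c)) := by
  unfold gaussianMatrix gm gvec gK
  have h1 : (Measure.pi fun _ : Fin c => Measure.map (stdGaussianEntry K) (Measure.pi fun _ : Bool => gaussianReal 0 1))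
     = Measure.map (fun (g : Fin c → Bool → ℝ) j => stdGaussianEntry K (g j))
        (Measure.pi fun _ : Fin c => Measure.pi fun _ : Bool => gaussianReal 0 1) := by
    rw [Measure.pi_map_pi (fun _ => measurable_stdGaussianEntry.aemeasurable)]
  have hm : Measurable (fun (g : Fin c → Bool → ℝ) j => stdGaussianEntry K (g j)) :=
    measurable_pi_lambda _ fun j => measurable_stdGaussianEntry.comp (measurable_pi_apply j)
  have : IsProbabilityMeasure (Measure.map (fun (g : Fin c → Bool → ℝ) j => stdGaussianEntry K (g j))
        (Measure.pi fun _ : Fin c => Measure.pi fun _ : Bool => gaussianReal 0 1)) := 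
    Measure.isProbabilityMeasure_map hm.aemeasurable
  rw [h1, ← Measure.pi_map_pi (fun _ => hm.aemeasurable)]
  rfl

lemma measurable_mulVec {ι κ : Type*} [Fintype ι] [Fintype κ] (V : Matrix κ ι K) :
    Measurable (fun g : ι → K => V *ᵥ g) := by
  refine measurable_pi_lambda _ fun i => ?_
  simp only [mulVec, dotProduct]
  fun_prop

/-- second moment of a linear form -/
lemma lintegral_linear_gvec {ι : Type*} [Fintype ι] (a : ι → K) :
    ∫⁻ g, ENNReal.ofReal (‖∑ i, a i * g i‖ ^ 2) ∂(gvec K ι) = ENNReal.ofReal (∑ i, ‖a i‖ ^ 2) := by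
  set N : ℝ := Real.sqrt (∑ i, ‖a i‖ ^ 2) with hN
  have hN2 : N ^ 2 = ∑ i, ‖a i‖ ^ 2 := Real.sq_sqrt (by positivity)
  by_cases h0 : N = 0
  · have : ∀ i, a i = 0 := by
      intro i
      have h1 : ∑ i, ‖a i‖ ^ 2 = 0 := by rw [← hN2, h0]; norm_num
      have := (Finset.sum_eq_zero_iff_of_nonneg (fun i _ => by positivity)).1 h1 i (Finset.mem_univ _)
      simpa using this
    simp [this]
  let V : Matrix ι Unit K := Matrix.of fun i _ => star (a i) / (N : K)
  have hV : Vᴴ * V = 1 := by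
    ext i j
    simp only [mul_apply, conjTranspose_apply, V, of_apply, one_apply]
    have hNK : (N : K) ≠ 0 := by exact_mod_cast h0
    have : ∀ x, star (star (a x) / (N : K)) * (star (a x) / (N : K)) = ((‖a x‖ ^ 2 : ℝ) : K) / (N : K) ^ 2 := by
      intro x
      simp only [star_div₀, RCLike.star_def, RCLike.conj_ofReal, RCLike.conj_conj]
      rw [div_mul_div_comm, RCLike.mul_conj, sq (N : K)]
      push_cast; rfl
    simp_rw [this]
    rw [← Finset.sum_div, ← RCLike.ofReal_sum, ← hN2]
    simp [hNK]
  have e : ∀ g : ι → K, ENNReal.ofReal (‖∑ i, a i * g i‖ ^ 2) =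
      ENNReal.ofReal (N ^ 2) * ENNReal.ofReal (‖(Vᴴ *ᵥ g) ()‖ ^ 2) := by
    intro g
    rw [← ENNReal.ofReal_mul (by positivity)]
    congr 1
    have : (Vᴴ *ᵥ g) () = (∑ i, a i * g i) / (N : K) := by
      simp only [mulVec, dotProduct, conjTranspose_apply, V, of_apply]
      rw [Finset.sum_div]
      refine Finset.sum_congr rfl fun x _ => ?_
      simp only [star_div₀, RCLike.star_def, RCLike.conj_ofReal, RCLike.conj_conj]
      ring
    rw [this, norm_div, div_pow, RCLike.norm_ofReal, sq_abs]
    field_simp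
  simp_rw [e]
  have hme : Measurable (fun f : Unit → K => ENNReal.ofReal (‖f ()‖ ^ 2)) := by fun_prop
  have hmc : Measurable (fun g : ι → K => ENNReal.ofReal (‖(Vᴴ *ᵥ g) ()‖ ^ 2)) :=
    hme.comp (measurable_mulVec Vᴴ)
  rw [lintegral_const_mul _ hmc, ← lintegral_map hme (measurable_mulVec Vᴴ), gvec_map V hV]
  have h3 := (measurePreserving_eval (fun _ : Unit => gK K) ()).lintegral_comp
      (f := fun x : K => ENNReal.ofReal (‖x‖ ^ 2)) (by fun_prop)
  unfold gvec
  simp only [Function.eval] at h3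
  rw [h3, lintegral_sq_gK, mul_one, hN2]

end gauss
end


noncomputable section
section det
variable {K : Type*} [RCLike K]
variable {ι κ τ : Type*} [Fintype ι] [Fintype κ] [Fintype τ] [DecidableEq ι] [DecidableEq κ] [DecidableEq τ]

/-- orthogonal projection matrix -/
def IsOP (P : Matrix ι ι K) : Prop := Pᴴ = P ∧ P * P = P

lemma frobSq_nonneg (A : Matrix ι κ K) : 0 ≤ frobSq A := by unfold frobSq; positivity

lemma frobSq_eq_trace (A : Matrix ι κ K) : ((frobSq A : ℝ) : K) = (Aᴴ * A).trace := by
  unfold frobSq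
  simp only [trace, diag, mul_apply, conjTranspose_apply]
  rw [Finset.sum_comm]
  push_cast
  refine Finset.sum_congr rfl fun i _ => Finset.sum_congr rfl fun j _ => ?_
  rw [RCLike.star_def, RCLike.conj_mul]

lemma frobSq_eq_re (A : Matrix ι κ K) : frobSq A = RCLike.re (Aᴴ * A).trace := by
  rw [← frobSq_eq_trace, RCLike.ofReal_re]

lemma frobSq_conjTranspose (A : Matrix ι κ K) : frobSq Aᴴ = frobSq A := by
  unfold frobSq
  rw [Finset.sum_comm]
  simp

lemma frobSq_eq_re' (A : Matrix ι κ K) : frobSq A = RCLike.re (A * Aᴴ).trace := by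
  rw [← frobSq_conjTranspose, frobSq_eq_re, conjTranspose_conjTranspose]

lemma frobSq_isom (V : Matrix τ ι K) (hV : Vᴴ * V = 1) (A : Matrix ι κ K) : frobSq (V * A) = frobSq A := by
  rw [frobSq_eq_re, frobSq_eq_re, conjTranspose_mul, Matrix.mul_assoc, ← Matrix.mul_assoc Vᴴ, hV, Matrix.one_mul]

lemma frobSq_add (A B : Matrix ι κ K) (h : Aᴴ * B = 0) : frobSq (A + B) = frobSq A + frobSq B := by
  have h' : Bᴴ * A = 0 := by
    rw [← conjTranspose_conjTranspose A, ← conjTranspose_mul, h, conjTranspose_zero]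
  rw [frobSq_eq_re, frobSq_eq_re, frobSq_eq_re, conjTranspose_add, Matrix.add_mul, Matrix.mul_add, Matrix.mul_add, h, h']
  simp

lemma frobSq_neg (A : Matrix ι κ K) : frobSq (-A) = frobSq A := by simp [frobSq]

lemma frobSq_sub (A B : Matrix ι κ K) (h : Aᴴ * B = 0) : frobSq (A - B) = frobSq A + frobSq B := by
  rw [sub_eq_add_neg, frobSq_add _ _ (by simp [h]), frobSq_neg]

lemma frobSq_proj_le (P : Matrix ι ι K) (hP : IsOP P) (A : Matrix ι κ K) : frobSq (P * A) ≤ frobSq A := by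
  have : A = P * A + (A - P * A) := by abel
  conv_rhs => rw [this]
  rw [frobSq_add]
  · linarith [frobSq_nonneg (A - P * A)]
  · rw [conjTranspose_mul, hP.1, Matrix.mul_sub, Matrix.mul_assoc, Matrix.mul_assoc, ← Matrix.mul_assoc P, hP.2, sub_self]

lemma IsOP.compl {P : Matrix ι ι K} (hP : IsOP P) : IsOP (1 - P) := by
  refine ⟨by rw [conjTranspose_sub, hP.1, conjTranspose_one], ?_⟩
  rw [Matrix.sub_mul, Matrix.one_mul, Matrix.mul_sub, Matrix.mul_one, hP.2, sub_self, sub_zero]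

lemma eq_zero_of_conjTranspose_mul_self {A : Matrix ι κ K} (h : Aᴴ * A = 0) : A = 0 :=
  Matrix.conjTranspose_mul_self_eq_zero.1 h

lemma IsOP.exists_frame {P : Matrix ι ι K} (hP : IsOP P) :
    ∃ (m : ℕ) (V : Matrix ι (Fin m) K), Vᴴ * V = 1 ∧ V * Vᴴ = P := by
  let S : Submodule K (EuclideanSpace K ι) := LinearMap.range (Matrix.toEuclideanLin P)
  let b := stdOrthonormalBasis K S
  refine ⟨_, Matrix.of fun i j => (b j : EuclideanSpace K ι) i, ?_, ?_⟩
  · ext i j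
    have h := b.orthonormal
    rw [orthonormal_iff_ite] at h
    have h2 := h i j
    rw [one_apply, ← h2]
    simp only [mul_apply, conjTranspose_apply, of_apply]
    rw [Submodule.coe_inner, PiLp.inner_apply]
    refine Finset.sum_congr rfl fun x _ => ?_
    simp [mul_comm]
  · set V : Matrix ι _ K := Matrix.of fun i j => (b j : EuclideanSpace K ι) i with hV
    -- P V = V
    have h1 : P * V = V := by
      ext i j
      obtain ⟨y, hy⟩ := (b j).2
      have e : (fun i => V i j) = P *ᵥ (WithLp.ofLp y) := by
        ext i; simp only [V, of_apply]; rw [← hy]; rfl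
      have : (P * V) i j = (P *ᵥ (fun i => V i j)) i := rfl
      rw [this, e, mulVec_mulVec, hP.2, ← e]
    have h1' : Vᴴ * P = Vᴴ := by
      rw [← hP.1, ← conjTranspose_mul, h1]
    -- V Vᴴ P = P
    have h2 : V * Vᴴ * P = P := by
      ext i j
      let y : EuclideanSpace K ι := WithLp.toLp 2 (fun i => P i j)
      have hy : y ∈ S := ⟨EuclideanSpace.single j 1, by
        ext i; simp [y, Matrix.toEuclideanLin]⟩
      have := b.sum_repr' ⟨y, hy⟩
      have h3 := congrArg (fun z : S => (z : EuclideanSpace K ι) i) this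
      simp only [Submodule.coe_sum, Submodule.coe_smul] at h3
      have h4 : ((⟨y, hy⟩ : S) : EuclideanSpace K ι) i = P i j := rfl
      rw [← h4, ← h3, Matrix.mul_assoc, mul_apply]
      rw [WithLp.ofLp_sum, Finset.sum_apply]
      refine Finset.sum_congr rfl fun x _ => ?_
      rw [WithLp.ofLp_smul, Pi.smul_apply, smul_eq_mul, mul_comm]
      simp only [V, of_apply]
      congr 1
      rw [Submodule.coe_inner, PiLp.inner_apply, mul_apply]
      refine Finset.sum_congr rfl fun x _ => ?_
      simp [y, mul_comm]
    rw [Matrix.mul_assoc, h1'] at h2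
    exact h2

lemma IsOP.exists_frame_of_trace {P : Matrix ι ι K} (hP : IsOP P) (m : ℕ) (h : P.trace = (m : K)) :
    ∃ (V : Matrix ι (Fin m) K), Vᴴ * V = 1 ∧ V * Vᴴ = P := by
  obtain ⟨m', V, h1, h2⟩ := hP.exists_frame
  have : m' = m := by
    have h3 : P.trace = (m' : K) := by
      rw [← h2, trace_mul_comm, h1, trace_one]; simp
    rw [h3] at h
    exact_mod_cast h
  subst this
  exact ⟨V, h1, h2⟩

lemma isOP_frame (V : Matrix ι κ K) (h : Vᴴ * V = 1) : IsOP (V * Vᴴ) := by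
  refine ⟨by simp, ?_⟩
  rw [Matrix.mul_assoc, ← Matrix.mul_assoc Vᴴ, h, Matrix.one_mul]

lemma trace_frame (V : Matrix ι κ K) (h : Vᴴ * V = 1) : (V * Vᴴ).trace = (Fintype.card κ : K) := by
  rw [trace_mul_comm, h, trace_one]

lemma card_le_of_frame (V : Matrix ι κ K) (h : Vᴴ * V = 1) : Fintype.card κ ≤ Fintype.card ι := by
  have h1 : (1 : Matrix κ κ K).rank ≤ V.rank := by rw [← h]; exact rank_mul_le_right _ _
  rw [rank_one] at h1
  exact h1.trans (rank_le_card_height V)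

/-- complete an orthonormal frame -/
lemma exists_compl_frame (V : Matrix ι κ K) (h : Vᴴ * V = 1) :
    ∃ V' : Matrix ι (Fin (Fintype.card ι - Fintype.card κ)) K, V'ᴴ * V' = 1 ∧ V * Vᴴ + V' * V'ᴴ = 1 ∧ Vᴴ * V' = 0 := by
  obtain ⟨V', h1, h2⟩ := (isOP_frame V h).compl.exists_frame_of_trace (Fintype.card ι - Fintype.card κ) (by
    rw [trace_sub, trace_frame V h, trace_one, Nat.cast_sub (card_le_of_frame V h)])
  refine ⟨V', h1, by rw [h2]; abel, ?_⟩
  have : (V'ᴴ * V)ᴴ * (V'ᴴ * V) = 0 := by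
    rw [conjTranspose_mul, conjTranspose_conjTranspose, Matrix.mul_assoc, ← Matrix.mul_assoc V', h2, Matrix.sub_mul,
      Matrix.mul_sub, Matrix.mul_assoc V, h]
    simp
  have := eq_zero_of_conjTranspose_mul_self this
  rw [← conjTranspose_conjTranspose (Vᴴ * V'), conjTranspose_mul, conjTranspose_conjTranspose, this, conjTranspose_zero]

lemma exists_unitary_transport (V W : Matrix ι κ K) (hV : Vᴴ * V = 1) (hW : Wᴴ * W = 1) :
    ∃ U : Matrix ι ι K, Uᴴ * U = 1 ∧ U * Uᴴ = 1 ∧ U * V = W := by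
  obtain ⟨V', v1, v2, v3⟩ := exists_compl_frame V hV
  obtain ⟨W', w1, w2, w3⟩ := exists_compl_frame W hW
  have v4 : V'ᴴ * V = 0 := by rw [← conjTranspose_conjTranspose V, ← conjTranspose_mul, v3, conjTranspose_zero]
  have w4 : W'ᴴ * W = 0 := by rw [← conjTranspose_conjTranspose W, ← conjTranspose_mul, w3, conjTranspose_zero]
  have key : (W * Vᴴ + W' * V'ᴴ)ᴴ * (W * Vᴴ + W' * V'ᴴ) = 1 := by
    rw [← v2]
    simp only [conjTranspose_add, conjTranspose_mul, conjTranspose_conjTranspose, Matrix.add_mul, Matrix.mul_add]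
    have a1 : V * Wᴴ * (W * Vᴴ) = V * Vᴴ := by rw [Matrix.mul_assoc, ← Matrix.mul_assoc Wᴴ, hW, Matrix.one_mul]
    have a2 : V' * W'ᴴ * (W' * V'ᴴ) = V' * V'ᴴ := by rw [Matrix.mul_assoc, ← Matrix.mul_assoc W'ᴴ, w1, Matrix.one_mul]
    have a3 : V * Wᴴ * (W' * V'ᴴ) = 0 := by rw [Matrix.mul_assoc, ← Matrix.mul_assoc Wᴴ, w3]; simp
    have a4 : V' * W'ᴴ * (W * Vᴴ) = 0 := by rw [Matrix.mul_assoc, ← Matrix.mul_assoc W'ᴴ, w4]; simp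
    rw [a1, a2, a3, a4]; simp
  refine ⟨W * Vᴴ + W' * V'ᴴ, key, mul_eq_one_comm.1 key, ?_⟩
  rw [Matrix.add_mul, Matrix.mul_assoc, hV, Matrix.mul_assoc, v4]; simp

/-- The Schur complement. -/
def Sc (P : Matrix ι ι K) (Y : Matrix ι κ K) : Matrix ι ι K :=
  P - P * Y * (Yᴴ * P * Y)⁻¹ * Yᴴ * P

section
variable {P : Matrix ι ι K} {Y : Matrix ι κ K}

lemma Sc_conjTranspose (hP : IsOP P) : (Sc P Y)ᴴ = Sc P Y := by
  unfold Sc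
  simp only [conjTranspose_sub, conjTranspose_mul, hP.1, conjTranspose_nonsing_inv, conjTranspose_conjTranspose, Matrix.mul_assoc]

lemma mul_Sc (hP : IsOP P) : P * Sc P Y = Sc P Y := by
  unfold Sc
  simp only [Matrix.mul_sub, ← Matrix.mul_assoc, hP.2]

lemma Sc_mul (hP : IsOP P) : Sc P Y * P = Sc P Y := by
  unfold Sc
  simp only [Matrix.sub_mul, Matrix.mul_assoc, hP.2]

lemma Sc_mul_Y (hd : IsUnit (Yᴴ * P * Y).det) : Sc P Y * Y = 0 := by
  unfold Sc
  rw [Matrix.sub_mul, Matrix.mul_assoc, Matrix.mul_assoc _ Yᴴ, Matrix.mul_assoc (P * Y),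
    ← Matrix.mul_assoc Yᴴ, Matrix.nonsing_inv_mul _ hd, Matrix.mul_one, sub_self]

lemma Y_mul_Sc (hP : IsOP P) (hd : IsUnit (Yᴴ * P * Y).det) : Yᴴ * Sc P Y = 0 := by
  rw [← Sc_conjTranspose hP, ← conjTranspose_mul, Sc_mul_Y hd, conjTranspose_zero]

lemma Sc_isOP (hP : IsOP P) (hd : IsUnit (Yᴴ * P * Y).det) : IsOP (Sc P Y) := by
  refine ⟨Sc_conjTranspose hP, ?_⟩
  conv_lhs => enter [2]; unfold Sc
  rw [Matrix.mul_sub, Sc_mul hP]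
  simp only [← Matrix.mul_assoc]
  rw [Sc_mul hP, Sc_mul_Y hd]; simp

lemma Sc_trace (hP : IsOP P) (hd : IsUnit (Yᴴ * P * Y).det) : (Sc P Y).trace = P.trace - (Fintype.card κ : K) := by
  unfold Sc
  rw [trace_sub]
  congr 1
  rw [Matrix.mul_assoc (P * Y * _), trace_mul_comm, ← Matrix.mul_assoc, ← Matrix.mul_assoc, Matrix.mul_assoc Yᴴ P P, hP.2,
    Matrix.mul_nonsing_inv _ hd, trace_one]

/-- coordinates: removing column `i` -/
lemma schur_entry (i : κ) {Y' : Matrix ι {j : κ // j ≠ i} K} (hY' : Y' = Y.submatrix id Subtype.val)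
    {u : Matrix ι Unit K} (hu : u = Y.submatrix id fun _ => i)
    (hd : IsUnit (Y'ᴴ * P * Y').det) (hs : (uᴴ * Sc P Y' * u) () () ≠ 0) :
    IsUnit (Yᴴ * P * Y).det ∧ (Yᴴ * P * Y)⁻¹ i i = ((uᴴ * Sc P Y' * u) () ())⁻¹ := by
  let e : {j : κ // j ≠ i} ⊕ Unit ≃ κ :=
    { toFun := Sum.elim Subtype.val (fun _ => i)
      invFun := fun j => if h : j = i then Sum.inr () else Sum.inl ⟨j, h⟩
      left_inv := by
        rintro (⟨j, hj⟩ | _)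
        · simp [hj]
        · simp
      right_inv := by
        intro j
        by_cases h : j = i <;> simp [h] }
  have hb : (Yᴴ * P * Y).submatrix e e =
      fromBlocks (Y'ᴴ * P * Y') (Y'ᴴ * P * u) (uᴴ * P * Y') (uᴴ * P * u) := by
    ext a b
    rcases a with a | a <;> rcases b with b | b <;> subst hY' hu <;> rfl
  have hD : uᴴ * P * u - uᴴ * P * Y' * (Y'ᴴ * P * Y')⁻¹ * (Y'ᴴ * P * u) = uᴴ * Sc P Y' * u := by
    unfold Sc
    simp only [Matrix.mul_sub, Matrix.sub_mul, Matrix.mul_assoc]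
  have hDu : IsUnit (uᴴ * Sc P Y' * u).det := by
    rw [det_unique]; exact isUnit_iff_ne_zero.2 hs
  have : Invertible (Y'ᴴ * P * Y') := Matrix.invertibleOfIsUnitDet _ hd
  have hD' : uᴴ * P * u - uᴴ * P * Y' * ⅟(Y'ᴴ * P * Y') * (Y'ᴴ * P * u) = uᴴ * Sc P Y' * u := by
    rw [invOf_eq_nonsing_inv, hD]
  have hdet : IsUnit (Yᴴ * P * Y).det := by
    rw [← det_submatrix_equiv_self e, hb, det_fromBlocks₁₁, hD']
    exact hd.mul hDu
  refine ⟨hdet, ?_⟩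
  have i2 : Invertible (uᴴ * P * u - uᴴ * P * Y' * ⅟(Y'ᴴ * P * Y') * (Y'ᴴ * P * u)) := by
    rw [hD']; exact Matrix.invertibleOfIsUnitDet _ hDu
  have i3 : Invertible (fromBlocks (Y'ᴴ * P * Y') (Y'ᴴ * P * u) (uᴴ * P * Y') (uᴴ * P * u)) :=
    fromBlocks₁₁Invertible _ _ _ _
  have h1 := invOf_fromBlocks₁₁_eq (Y'ᴴ * P * Y') (Y'ᴴ * P * u) (uᴴ * P * Y') (uᴴ * P * u)
  rw [invOf_eq_nonsing_inv, ← hb, inv_submatrix_equiv] at h1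
  have h2 := congrFun (congrFun h1 (Sum.inr ())) (Sum.inr ())
  simp only [submatrix_apply, fromBlocks_apply₂₂] at h2
  have h3 : e (Sum.inr ()) = i := rfl
  rw [h3, invOf_eq_nonsing_inv, hD'] at h2
  rw [h2, inv_def, det_unique, adjugate_subsingleton]
  simp
end

end det
end


noncomputable section
section meas
variable {K : Type*} [RCLike K] [MeasurableSpace K] [BorelSpace K]
variable {ι κ τ : Type*} [Fintype ι] [Fintype κ] [Fintype τ] [DecidableEq ι] [DecidableEq κ] [DecidableEq τ]
variable {X : Type*} [MeasurableSpace X]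

lemma measurable_mat {f : X → Matrix ι κ K} (h : ∀ i j, Measurable fun x => f x i j) : Measurable f :=
  measurable_pi_iff.2 fun i => measurable_pi_iff.2 fun j => h i j

lemma Measurable.matEntry {f : X → Matrix ι κ K} (h : Measurable f) (i : ι) (j : κ) : Measurable fun x => f x i j :=
  (measurable_pi_apply (X := fun _ : κ => K) j).comp ((measurable_pi_apply (X := fun _ : ι => κ → K) i).comp h)

@[fun_prop]
lemma Measurable.matMul {f : X → Matrix ι κ K} {g : X → Matrix κ τ K} (hf : Measurable f) (hg : Measurable g) :
    Measurable fun x => f x * g x := by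
  refine measurable_mat fun i j => ?_
  simp only [mul_apply]
  exact Finset.measurable_sum _ fun k _ => (hf.matEntry i k).mul (hg.matEntry k j)

@[fun_prop]
lemma Measurable.matSub {f g : X → Matrix ι κ K} (hf : Measurable f) (hg : Measurable g) :
    Measurable fun x => f x - g x := measurable_mat fun i j => (hf.matEntry i j).sub (hg.matEntry i j)

@[fun_prop]
lemma Measurable.matStar {f : X → Matrix ι κ K} (hf : Measurable f) :
    Measurable fun x => (f x)ᴴ := measurable_mat fun i j => by
  simp only [conjTranspose_apply]
  exact (RCLike.continuous_conj.measurable).comp (hf.matEntry j i)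

@[fun_prop]
lemma Measurable.matDet {f : X → Matrix ι ι K} (hf : Measurable f) :
    Measurable fun x => (f x).det := by
  simp only [det_apply]
  refine Finset.measurable_sum _ fun s _ => ?_
  have : Measurable fun x => ∏ i, f x (s i) i := Finset.measurable_prod _ fun i _ => hf.matEntry _ _
  simp only [Units.smul_def, zsmul_eq_mul]
  exact this.const_mul _

@[fun_prop]
lemma Measurable.matInv {f : X → Matrix ι ι K} (hf : Measurable f) :
    Measurable fun x => (f x)⁻¹ := by
  refine measurable_mat fun i j => ?_
  simp only [inv_def, Ring.inverse_eq_inv', Matrix.smul_apply, smul_eq_mul, adjugate_apply]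
  refine hf.matDet.inv.mul (Measurable.matDet (measurable_mat fun a b => ?_))
  simp only [updateRow_apply]
  by_cases h : a = j
  · simp [h]
  · simpa [h] using hf.matEntry a b

@[fun_prop]
lemma Measurable.matVec {f : X → Matrix ι κ K} {g : X → κ → K} (hf : Measurable f) (hg : Measurable g) :
    Measurable fun x => f x *ᵥ g x := by
  refine measurable_pi_lambda _ fun i => ?_
  simp only [mulVec, dotProduct]
  exact Finset.measurable_sum _ fun k _ => (hf.matEntry i k).mul ((measurable_pi_apply k).comp hg)

/-- squared euclidean norm -/
def nsq {K : Type*} [RCLike K] {ι : Type*} [Fintype ι] (v : ι → K) : ℝ := ∑ i, ‖v i‖ ^ 2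

@[fun_prop]
lemma Measurable.nsq' {f : X → ι → K} (hf : Measurable f) : Measurable fun x => nsq (f x) := by
  unfold nsq; fun_prop

@[fun_prop]
lemma Measurable.frobSq' {f : X → Matrix ι κ K} (hf : Measurable f) : Measurable fun x => frobSq (f x) := by
  unfold frobSq
  exact Finset.measurable_sum _ fun i _ => Finset.measurable_sum _ fun j _ => (hf.matEntry i j).norm.pow_const 2

@[fun_prop]
lemma Measurable.Sc' {f : X → Matrix ι ι K} {g : X → Matrix ι κ K} (hf : Measurable f) (hg : Measurable g) :
    Measurable fun x => Sc (f x) (g x) := by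
  unfold Sc; fun_prop

lemma nsq_nonneg (v : ι → K) : 0 ≤ nsq v := by unfold nsq; positivity
lemma nsq_eq (v : ι → K) : ((nsq v : ℝ) : K) = star v ⬝ᵥ v := (star_dotProduct_self' v).symm
lemma nsq_eq_zero {v : ι → K} : nsq v = 0 ↔ v = 0 := by
  unfold nsq
  rw [Finset.sum_eq_zero_iff_of_nonneg (fun i _ => by positivity)]
  simp [funext_iff]
lemma nsq_isom (V : Matrix ι κ K) (hV : Vᴴ * V = 1) (a : κ → K) : nsq (V *ᵥ a) = nsq a :=
  norm_sq_mulVec_isometry V hV a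
lemma nsq_smul (c : K) (v : ι → K) : nsq (c • v) = ‖c‖ ^ 2 * nsq v := by
  simp [nsq, mul_pow, Finset.mul_sum]
lemma nsq_eq_dot {P : Matrix ι ι K} (hP : IsOP P) (v : ι → K) : ((nsq (P *ᵥ v) : ℝ) : K) = star v ⬝ᵥ (P *ᵥ v) := by
  rw [nsq_eq, star_mulVec, hP.1, ← dotProduct_mulVec, mulVec_mulVec, hP.2]
lemma nsq_op_add {P Q : Matrix ι ι K} (hP : IsOP P) (hQ : IsOP Q) (hPQ : IsOP (P + Q)) (v : ι → K) :
    nsq ((P + Q) *ᵥ v) = nsq (P *ᵥ v) + nsq (Q *ᵥ v) := by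
  have : ((nsq ((P + Q) *ᵥ v) : ℝ) : K) = ((nsq (P *ᵥ v) + nsq (Q *ᵥ v) : ℝ) : K) := by
    rw [RCLike.ofReal_add, nsq_eq_dot hP, nsq_eq_dot hQ, nsq_eq_dot hPQ, add_mulVec, dotProduct_add]
  exact_mod_cast this

lemma nsq_frame (V : Matrix ι κ K) (hV : Vᴴ * V = 1) (a : ι → K) : nsq ((V * Vᴴ) *ᵥ a) = nsq (Vᴴ *ᵥ a) := by
  rw [← mulVec_mulVec, nsq_isom V hV]

lemma lintegral_inv_proj {S : Matrix ι ι K} (hS : IsOP S) (m : ℕ) (ht : S.trace = (m : K)) (h : 1 + alphaK K < m) :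
    ∫⁻ g, (ENNReal.ofReal (nsq (S *ᵥ g)))⁻¹ ∂(gvec K ι) ≤ ENNReal.ofReal (1 / (m - 1 - alphaK K)) := by
  obtain ⟨V, h1, h2⟩ := hS.exists_frame_of_trace m ht
  have e : ∀ g, nsq (S *ᵥ g) = nsq (Vᴴ *ᵥ g) := fun g => by rw [← h2, nsq_frame V h1]
  simp_rw [e]
  have hm : Measurable fun x : Fin m → K => (ENNReal.ofReal (nsq x))⁻¹ := by fun_prop
  rw [← lintegral_map hm (measurable_mulVec Vᴴ), gvec_map V h1]
  have := lintegral_inv_gvec (K := K) (ι := Fin m) (by simpa using h)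
  simpa [nsq] using this

lemma lintegral_nsq_gvec : ∫⁻ g, ENNReal.ofReal (nsq g) ∂(gvec K ι) = ENNReal.ofReal (Fintype.card ι) := by
  unfold nsq
  simp_rw [fun g : ι → K => ENNReal.ofReal_sum_of_nonneg (s := Finset.univ) (f := fun i => ‖g i‖ ^ 2) (fun i _ => by positivity)]
  rw [lintegral_finsetSum _ (fun i _ => by fun_prop)]
  have : ∀ i : ι, ∫⁻ g, ENNReal.ofReal (‖g i‖ ^ 2) ∂(gvec K ι) = 1 := by
    intro i
    have h3 := (measurePreserving_eval (fun _ : ι => gK K) i).lintegral_comp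
      (f := fun x : K => ENNReal.ofReal (‖x‖ ^ 2)) (by fun_prop)
    unfold gvec
    simp only [Function.eval] at h3
    rw [h3, lintegral_sq_gK]
  simp_rw [this]
  simp

lemma ratio_bound {S T : Matrix ι ι K} (hS : IsOP S) (hT : IsOP T) (h0 : S * T = 0) (m p : ℕ)
    (ht : S.trace = (m : K)) (ht' : T.trace = (p : K)) (h : 1 + alphaK K < m) :
    ∫⁻ g, ENNReal.ofReal (nsq (S *ᵥ g) + nsq (T *ᵥ g)) * (ENNReal.ofReal (nsq (S *ᵥ g)))⁻¹ ∂(gvec K ι) ≤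
      ENNReal.ofReal (1 + p / (m - 1 - alphaK K)) := by
  obtain ⟨V, h1, h2⟩ := hS.exists_frame_of_trace m ht
  obtain ⟨W, h3, h4⟩ := hT.exists_frame_of_trace p ht'
  have hVW : Vᴴ * W = 0 := by
    have : Vᴴ * (S * T) * W = 0 := by rw [h0]; simp
    rw [← h2, ← h4] at this
    simp only [← Matrix.mul_assoc] at this
    rw [h1, Matrix.one_mul, Matrix.mul_assoc, h3, Matrix.mul_one] at this
    exact this
  have hWV : Wᴴ * V = 0 := by rw [← conjTranspose_conjTranspose V, ← conjTranspose_mul, hVW, conjTranspose_zero]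
  let Z : Matrix ι (Fin m ⊕ Fin p) K := fromCols V W
  have hZ : Zᴴ * Z = 1 := by
    simp only [Z, conjTranspose_fromCols_eq_fromRows_conjTranspose, fromRows_mul_fromCols, h1, h3, hVW, hWV, fromBlocks_one]
  have e : ∀ g, nsq (S *ᵥ g) = nsq (fun i => (Zᴴ *ᵥ g) (Sum.inl i)) := fun g => by rw [← h2, nsq_frame V h1]; rfl
  have e' : ∀ g, nsq (T *ᵥ g) = nsq (fun i => (Zᴴ *ᵥ g) (Sum.inr i)) := fun g => by rw [← h4, nsq_frame W h3]; rfl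
  simp_rw [e, e']
  have hm : Measurable fun x : (Fin m ⊕ Fin p) → K =>
    ENNReal.ofReal (nsq (fun i => x (Sum.inl i)) + nsq (fun i => x (Sum.inr i))) * (ENNReal.ofReal (nsq (fun i => x (Sum.inl i))))⁻¹ := by fun_prop
  rw [← lintegral_map (f := fun x : (Fin m ⊕ Fin p) → K =>
    ENNReal.ofReal (nsq (fun i => x (Sum.inl i)) + nsq (fun i => x (Sum.inr i))) * (ENNReal.ofReal (nsq (fun i => x (Sum.inl i))))⁻¹) hm (measurable_mulVec Zᴴ), gvec_map Z hZ]
  have mp := measurePreserving_sumPiEquivProdPi (X := fun _ : Fin m ⊕ Fin p => K) (fun _ => gK K)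
  have h5 := mp.lintegral_comp (f := fun y : (Fin m → K) × (Fin p → K) =>
    ENNReal.ofReal (nsq y.1 + nsq y.2) * (ENNReal.ofReal (nsq y.1))⁻¹) (by fun_prop)
  have h6 : ∫⁻ x : (Fin m ⊕ Fin p) → K,
    ENNReal.ofReal (nsq (fun i => x (Sum.inl i)) + nsq (fun i => x (Sum.inr i))) * (ENNReal.ofReal (nsq (fun i => x (Sum.inl i))))⁻¹ ∂(gvec K (Fin m ⊕ Fin p)) = ∫⁻ y : (Fin m → K) × (Fin p → K),
    ENNReal.ofReal (nsq y.1 + nsq y.2) * (ENNReal.ofReal (nsq y.1))⁻¹ ∂((gvec K (Fin m)).prod (gvec K (Fin p))) := h5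
  rw [h6]
  have hpos : 0 < (m : ℝ) - 1 - alphaK K := by linarith
  calc _ ≤ ∫⁻ y : (Fin m → K) × (Fin p → K), (1 + (ENNReal.ofReal (nsq y.1))⁻¹ * ENNReal.ofReal (nsq y.2)) ∂((gvec K (Fin m)).prod (gvec K (Fin p))) := by
        refine lintegral_mono fun y => ?_
        simp only
        rw [ENNReal.ofReal_add (nsq_nonneg _) (nsq_nonneg _), add_mul, mul_comm (ENNReal.ofReal (nsq y.2))]
        gcongr
        exact ENNReal.mul_inv_le_one _
    _ = 1 + (∫⁻ x : Fin m → K, (ENNReal.ofReal (nsq x))⁻¹ ∂(gvec K (Fin m))) * ENNReal.ofReal p := by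
        rw [lintegral_add_left (by fun_prop)]
        rw [lintegral_prod_mul (f := fun x : Fin m → K => (ENNReal.ofReal (nsq x))⁻¹) (g := fun x : Fin p → K => (ENNReal.ofReal (nsq x))) (by fun_prop) (by fun_prop), lintegral_nsq_gvec]
        simp
    _ ≤ 1 + ENNReal.ofReal (1 / (m - 1 - alphaK K)) * ENNReal.ofReal p := by
        gcongr
        have := lintegral_inv_gvec (K := K) (ι := Fin m) (by simpa using h)
        simpa [nsq] using this
    _ = _ := by
        rw [← ENNReal.ofReal_mul (by positivity), ← ENNReal.ofReal_one, ← ENNReal.ofReal_add zero_le_one (by positivity)]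
        congr 1
        field_simp

end meas
end


noncomputable section
section rp
variable {K : Type*} [RCLike K] [MeasurableSpace K] [BorelSpace K]
variable {ι κ τ σ : Type*} [Fintype ι] [Fintype κ] [Fintype τ] [Fintype σ] [DecidableEq ι] [DecidableEq κ] [DecidableEq τ] [DecidableEq σ]

/-- law of a uniformly random projection of rank `k` -/
structure RP (ν : Measure (Matrix ι ι K)) (k : ℕ) : Prop where
  prob : IsProbabilityMeasure ν
  ae : ∀ᵐ P ∂ν, IsOP P ∧ P.trace = (k : K)
  inv : ∀ U : Matrix ι ι K, Uᴴ * U = 1 → U * Uᴴ = 1 → Measure.map (fun P => U * P * Uᴴ) ν = ν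

lemma RP.k_le {ν : Measure (Matrix ι ι K)} {k : ℕ} (hν : RP ν k) : k ≤ Fintype.card ι := by
  have := hν.prob
  obtain ⟨P, hP, ht⟩ := hν.ae.exists
  obtain ⟨V, h1, _⟩ := hP.exists_frame_of_trace k ht
  simpa using card_le_of_frame V h1

lemma frame_extend {Y : Matrix ι κ K} (hY : Yᴴ * Y = 1) {u : ι → K} (hu : Yᴴ *ᵥ u = 0) (h1 : nsq u = 1) :
    (fromCols Y (replicateCol Unit u))ᴴ * fromCols Y (replicateCol Unit u) = 1 := by
  have a : Yᴴ * replicateCol Unit u = 0 := by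
    ext i j; exact congrFun hu i
  have b : (replicateCol Unit u)ᴴ * Y = 0 := by
    rw [← conjTranspose_conjTranspose Y, ← conjTranspose_mul, a, conjTranspose_zero]
  have c : (replicateCol Unit u)ᴴ * replicateCol Unit u = 1 := by
    ext i j
    have := nsq_eq u
    rw [h1] at this
    simp only [mul_apply, conjTranspose_apply, replicateCol_apply, one_apply]
    simpa [dotProduct] using this.symm
  rw [conjTranspose_fromCols_eq_fromRows_conjTranspose, fromRows_mul_fromCols, hY, a, b, c, fromBlocks_one]

lemma exists_rot {Y : Matrix ι κ K} (hY : Yᴴ * Y = 1) {b b' : ι → K} (hb : Yᴴ *ᵥ b = 0) (hb' : Yᴴ *ᵥ b' = 0)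
    (hn : nsq b = nsq b') : ∃ U : Matrix ι ι K, Uᴴ * U = 1 ∧ U * Uᴴ = 1 ∧ U * Y = Y ∧ U *ᵥ b = b' := by
  by_cases h0 : nsq b = 0
  · have h0' := h0
    rw [hn] at h0'
    rw [nsq_eq_zero] at h0 h0'
    exact ⟨1, by simp, by simp, by simp, by simp [h0, h0']⟩
  set N : ℝ := Real.sqrt (nsq b) with hN
  have hNN : N ^ 2 = nsq b := Real.sq_sqrt (nsq_nonneg b)
  have hN0 : N ≠ 0 := by intro h; rw [h] at hNN; exact h0 (by rw [← hNN]; norm_num)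
  have hNK : (N : K) ≠ 0 := by exact_mod_cast hN0
  have n1 : ∀ c : ι → K, nsq c = nsq b → nsq ((N : K)⁻¹ • c) = 1 := by
    intro c hc
    rw [nsq_smul, hc, ← hNN, norm_inv, RCLike.norm_ofReal, inv_pow, sq_abs]
    field_simp
  obtain ⟨U, u1, u2, u3⟩ := exists_unitary_transport _ _
    (frame_extend hY (u := (N : K)⁻¹ • b) (by rw [mulVec_smul, hb, smul_zero]) (n1 b rfl))
    (frame_extend hY (u := (N : K)⁻¹ • b') (by rw [mulVec_smul, hb', smul_zero]) (n1 b' hn.symm))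
  rw [mul_fromCols] at u3
  have u4 := fromCols_inj u3
  refine ⟨U, u1, u2, u4.1, ?_⟩
  have : U *ᵥ ((N : K)⁻¹ • b) = (N : K)⁻¹ • b' := by
    ext i
    exact congrFun (congrFun u4.2 i) ()
  rw [mulVec_smul] at this
  exact smul_right_injective _ (inv_ne_zero hNK) this

lemma RP.rot_eq {ν : Measure (Matrix ι ι K)} {k : ℕ} (hν : RP ν k) {Y : Matrix ι κ K} (hY : Yᴴ * Y = 1)
    (h : Matrix ι ι K → (ι → K) → ℝ≥0∞) (hm : ∀ b, Measurable fun P => h P b)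
    (hinv : ∀ U : Matrix ι ι K, Uᴴ * U = 1 → U * Uᴴ = 1 → U * Y = Y → ∀ P b, h (U * P * Uᴴ) (U *ᵥ b) = h P b)
    (b b' : ι → K) (hb : Yᴴ *ᵥ b = 0) (hb' : Yᴴ *ᵥ b' = 0) (hn : nsq b = nsq b') :
    ∫⁻ P, h P b ∂ν = ∫⁻ P, h P b' ∂ν := by
  obtain ⟨U, u1, u2, u3, u4⟩ := exists_rot hY hb hb' hn
  conv_rhs => rw [← hν.inv U u1 u2]
  rw [lintegral_map (hm b') (by fun_prop)]
  refine lintegral_congr fun P => ?_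
  rw [← u4, hinv U u1 u2 u3]

lemma gram_rot {U : Matrix ι ι K} (hU : Uᴴ * U = 1) {Y : Matrix ι κ K} (h : U * Y = Y) (P : Matrix ι ι K) :
    Yᴴ * (U * P * Uᴴ) = Yᴴ * P * Uᴴ ∧ (U * P * Uᴴ) * Y = U * P * Y ∧ Yᴴ * (U * P * Uᴴ) * Y = Yᴴ * P * Y := by
  have a : Uᴴ * Y = Y := by conv_lhs => rw [← h, ← Matrix.mul_assoc, hU, Matrix.one_mul]
  have b : Yᴴ * U = Yᴴ := by
    rw [← conjTranspose_conjTranspose U, ← conjTranspose_mul, a]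
  refine ⟨?_, ?_, ?_⟩
  · simp only [← Matrix.mul_assoc, b]
  · simp only [Matrix.mul_assoc, a]
  · simp only [← Matrix.mul_assoc, b]; simp only [Matrix.mul_assoc, a]

lemma Sc_rot {U : Matrix ι ι K} (hU : Uᴴ * U = 1) {Y : Matrix ι κ K} (h : U * Y = Y) (P : Matrix ι ι K) :
    Sc (U * P * Uᴴ) Y = U * Sc P Y * Uᴴ := by
  obtain ⟨a, b, c⟩ := gram_rot hU h P
  unfold Sc
  rw [c, b, Matrix.mul_assoc _ Yᴴ, a]
  simp only [Matrix.mul_sub, Matrix.sub_mul, Matrix.mul_assoc]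

lemma isOP_sub {S Q : Matrix ι ι K} (hS : IsOP S) (hQ : IsOP Q) (h : S * Q = S) : IsOP (Q - S) := by
  have h' : Q * S = S := by
    have := congrArg conjTranspose h
    rwa [conjTranspose_mul, hS.1, hQ.1] at this
  refine ⟨by rw [conjTranspose_sub, hS.1, hQ.1], ?_⟩
  rw [Matrix.sub_mul, Matrix.mul_sub, Matrix.mul_sub, hQ.2, h, h', hS.2]; simp

lemma RP.L0 {ν : Measure (Matrix ι ι K)} {k : ℕ} (hν : RP ν k) {Y : Matrix ι κ K} (hY : Yᴴ * Y = 1)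
    (hdet : ∀ᵐ P ∂ν, IsUnit (Yᴴ * P * Y).det) {u : ι → K} (hu : Yᴴ *ᵥ u = 0) (hu1 : nsq u = 1)
    (hk : (Fintype.card κ : ℝ) + 1 + alphaK K < k) :
    ∫⁻ P, (ENNReal.ofReal (nsq (Sc P Y *ᵥ u)))⁻¹ ∂ν ≤
      ENNReal.ofReal (1 + ((Fintype.card ι : ℝ) - k) / (k - Fintype.card κ - 1 - alphaK K)) := by
  have := hν.prob
  have hα := alphaK_nonneg (K := K)
  have hkd := hν.k_le
  have hsk : Fintype.card κ ≤ k := by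
    have : (Fintype.card κ : ℝ) ≤ k := by linarith
    exact_mod_cast this
  have hsd := hsk.trans hkd
  set Q : Matrix ι ι K := 1 - Y * Yᴴ with hQd
  have hQ : IsOP Q := (isOP_frame Y hY).compl
  have hQt : Q.trace = ((Fintype.card ι - Fintype.card κ : ℕ) : K) := by
    rw [hQd, trace_sub, trace_frame Y hY, trace_one, Nat.cast_sub hsd]
  have hYQ : Yᴴ * Q = 0 := by
    rw [hQd, Matrix.mul_sub, ← Matrix.mul_assoc, hY]; simp
  have hae : ∀ᵐ g ∂(gvec K ι), nsq (Q *ᵥ g) ≠ 0 := by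
    have h1 := lintegral_inv_proj hQ _ hQt (by
      rw [Nat.cast_sub hsd]
      have : (k : ℝ) ≤ Fintype.card ι := by exact_mod_cast hkd
      linarith)
    have h2 := ae_lt_top (f := fun g : ι → K => (ENNReal.ofReal (nsq (Q *ᵥ g)))⁻¹) (by fun_prop) (h1.trans_lt ENNReal.ofReal_lt_top).ne
    filter_upwards [h2] with g hg h0
    simp [h0] at hg
  set I := ∫⁻ P, (ENNReal.ofReal (nsq (Sc P Y *ᵥ u)))⁻¹ ∂ν with hI
  have key : ∀ᵐ g ∂(gvec K ι), I = ∫⁻ P, ENNReal.ofReal (nsq (Q *ᵥ g)) * (ENNReal.ofReal (nsq (Sc P Y *ᵥ (Q *ᵥ g))))⁻¹ ∂ν := by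
    filter_upwards [hae] with g hg
    have hc : 0 < nsq (Q *ᵥ g) := lt_of_le_of_ne (nsq_nonneg _) (Ne.symm hg)
    set c := nsq (Q *ᵥ g) with hcd
    rw [lintegral_const_mul _ (by fun_prop)]
    rw [hν.rot_eq hY (fun P b => (ENNReal.ofReal (nsq (Sc P Y *ᵥ b)))⁻¹) (fun b => by fun_prop) ?_ (Q *ᵥ g)
      ((Real.sqrt c : K) • u) ?_ ?_ ?_]
    · rw [← lintegral_const_mul _ (by fun_prop), hI]
      refine lintegral_congr fun P => ?_
      rw [mulVec_smul, nsq_smul, RCLike.norm_ofReal, sq_abs, Real.sq_sqrt hc.le, ENNReal.ofReal_mul hc.le,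
        ENNReal.mul_inv (Or.inl (by simpa using hc)) (Or.inl (by simp)), ← mul_assoc,
        ENNReal.mul_inv_cancel (by simpa using hc) (by simp), one_mul]
    · intro U u1 u2 u3 P b
      rw [Sc_rot u1 u3, mulVec_mulVec, Matrix.mul_assoc, u1, Matrix.mul_one, ← mulVec_mulVec, nsq_isom U u1]
    · rw [mulVec_mulVec, hYQ, zero_mulVec]
    · rw [mulVec_smul, hu, smul_zero]
    · rw [nsq_smul, RCLike.norm_ofReal, sq_abs, Real.sq_sqrt hc.le, hu1, mul_one]
  have h3 : I = ∫⁻ g, I ∂(gvec K ι) := by simp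
  rw [h3, lintegral_congr_ae key, lintegral_lintegral_swap (by fun_prop)]
  have hb : ∀ᵐ P ∂ν, ∫⁻ g, ENNReal.ofReal (nsq (Q *ᵥ g)) * (ENNReal.ofReal (nsq (Sc P Y *ᵥ (Q *ᵥ g))))⁻¹ ∂(gvec K ι) ≤
      ENNReal.ofReal (1 + ((Fintype.card ι : ℝ) - k) / (k - Fintype.card κ - 1 - alphaK K)) := by
    filter_upwards [hν.ae, hdet] with P hP hd
    set S := Sc P Y with hS
    have hSop : IsOP S := Sc_isOP hP.1 hd
    have hSY : S * Y = 0 := Sc_mul_Y hd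
    have hSQ : S * Q = S := by rw [hQd, Matrix.mul_sub, ← Matrix.mul_assoc, hSY]; simp
    have hT := isOP_sub hSop hQ hSQ
    have hSt : S.trace = ((k - Fintype.card κ : ℕ) : K) := by rw [hS, Sc_trace hP.1 hd, hP.2, Nat.cast_sub hsk]
    have := ratio_bound hSop hT (by rw [Matrix.mul_sub, hSQ, hSop.2, sub_self]) (k - Fintype.card κ) (Fintype.card ι - k)
      hSt (by rw [trace_sub, hQt, hSt, Nat.cast_sub hsd, Nat.cast_sub hsk, Nat.cast_sub hkd]; ring)
      (by rw [Nat.cast_sub hsk]; linarith)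
    rw [Nat.cast_sub hsk, Nat.cast_sub hkd] at this
    refine le_trans (le_of_eq ?_) this
    refine lintegral_congr fun g => ?_
    rw [mulVec_mulVec, hSQ]
    congr 2
    rw [← nsq_op_add hSop hT (by simpa using hQ)]
    simp
  calc _ ≤ ∫⁻ P, ENNReal.ofReal (1 + ((Fintype.card ι : ℝ) - k) / (k - Fintype.card κ - 1 - alphaK K)) ∂ν := lintegral_mono_ae hb
    _ = _ := by simp

/-- vector version of the Schur complement formula -/
lemma schur_vec {P : Matrix ι ι K} (hP : IsOP P) (Y : Matrix ι κ K) (i : κ)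
    (hd : IsUnit ((Y.submatrix id (Subtype.val : {j : κ // j ≠ i} → κ))ᴴ * P * (Y.submatrix id (Subtype.val : {j : κ // j ≠ i} → κ))).det)
    (hs : nsq (Sc P (Y.submatrix id (Subtype.val : {j : κ // j ≠ i} → κ)) *ᵥ fun a => Y a i) ≠ 0) :
    IsUnit (Yᴴ * P * Y).det ∧ (Yᴴ * P * Y)⁻¹ i i =
      (((nsq (Sc P (Y.submatrix id (Subtype.val : {j : κ // j ≠ i} → κ)) *ᵥ fun a => Y a i))⁻¹ : ℝ) : K) := by
  have hop := Sc_isOP hP hd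
  set Y' := Y.submatrix id (Subtype.val : {j : κ // j ≠ i} → κ)
  set u : Matrix ι Unit K := Y.submatrix id fun _ => i with hu
  have e : (uᴴ * Sc P Y' * u) () () = ((nsq (Sc P Y' *ᵥ fun a => Y a i) : ℝ) : K) := by
    rw [nsq_eq_dot hop, Matrix.mul_assoc]
    rfl
  have := schur_entry (P := P) (Y := Y) i (Y' := Y') rfl hu hd (by rw [e]; exact_mod_cast hs)
  refine ⟨this.1, ?_⟩
  rw [this.2, e, RCLike.ofReal_inv]

lemma submatrix_frame {Y : Matrix ι κ K} (hY : Yᴴ * Y = 1) (i : κ) :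
    (Y.submatrix id (Subtype.val : {j : κ // j ≠ i} → κ))ᴴ * (Y.submatrix id (Subtype.val : {j : κ // j ≠ i} → κ)) = 1 := by
  ext a b
  have := congrFun (congrFun hY a.1) b.1
  have h2 : ((Y.submatrix id (Subtype.val : {j : κ // j ≠ i} → κ))ᴴ * (Y.submatrix id (Subtype.val : {j : κ // j ≠ i} → κ))) a b = (Yᴴ * Y) a.1 b.1 := rfl
  rw [h2, this, one_apply, one_apply]
  simp only [Subtype.ext_iff]

lemma col_nsq {Y : Matrix ι κ K} (hY : Yᴴ * Y = 1) (i : κ) : nsq (fun a => Y a i) = 1 := by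
  have := congrFun (congrFun hY i) i
  have h2 := nsq_eq (fun a => Y a i)
  have h3 : star (fun a => Y a i) ⬝ᵥ (fun a => Y a i) = (Yᴴ * Y) i i := rfl
  rw [h3, this, one_apply_eq] at h2
  exact_mod_cast h2

lemma col_orth {Y : Matrix ι κ K} (hY : Yᴴ * Y = 1) (i : κ) :
    (Y.submatrix id (Subtype.val : {j : κ // j ≠ i} → κ))ᴴ *ᵥ (fun a => Y a i) = 0 := by
  ext a
  have := congrFun (congrFun hY a.1) i
  have h3 : ((Y.submatrix id (Subtype.val : {j : κ // j ≠ i} → κ))ᴴ *ᵥ (fun a => Y a i)) a = (Yᴴ * Y) a.1 i := rfl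
  rw [h3, this, one_apply_ne a.2]; rfl

lemma card_ne (i : κ) : (Fintype.card {j : κ // j ≠ i} : ℝ) = Fintype.card κ - 1 := by
  have h0 : 0 < Fintype.card κ := Fintype.card_pos_iff.2 ⟨i⟩
  rw [Fintype.card_subtype_compl, Nat.cast_sub]
  · simp
  · rw [Fintype.card_unique]; exact h0

lemma ae_ne_zero_of_lintegral_inv {X : Type*} [MeasurableSpace X] {ν : Measure X} {f : X → ℝ} (hf : Measurable f) {c : ℝ}
    (h : ∫⁻ x, (ENNReal.ofReal (f x))⁻¹ ∂ν ≤ ENNReal.ofReal c) : ∀ᵐ x ∂ν, f x ≠ 0 := by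
  have h2 := ae_lt_top (f := fun x => (ENNReal.ofReal (f x))⁻¹) (by fun_prop) (h.trans_lt ENNReal.ofReal_lt_top).ne
  filter_upwards [h2] with g hg h0
  simp [h0] at hg

lemma RP.L1 {ν : Measure (Matrix ι ι K)} {k : ℕ} (hν : RP ν k) : ∀ (m : ℕ) (κ : Type*) [Fintype κ] [DecidableEq κ]
    (Y : Matrix ι κ K) (_ : Yᴴ * Y = 1) (_ : Fintype.card κ = m) (_ : (Fintype.card κ : ℝ) + alphaK K < k),
    ∀ᵐ P ∂ν, IsUnit (Yᴴ * P * Y).det := by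
  intro m
  induction m with
  | zero =>
    intro κ _ _ Y hY hc _
    have : IsEmpty κ := Fintype.card_eq_zero_iff.1 hc
    simp [det_isEmpty]
  | succ m ih =>
    intro κ _ _ Y hY hc hk
    have hne : Nonempty κ := Fintype.card_pos_iff.1 (by omega)
    obtain ⟨i⟩ := hne
    have hci := card_ne (κ := κ) i
    have h1 := ih {j : κ // j ≠ i} _ (submatrix_frame hY i) (by
      rw [hc] at hci; push_cast at hci
      have : (Fintype.card {j : κ // j ≠ i} : ℝ) = m := by linarith
      exact_mod_cast this) (by linarith)
    have h2 := hν.L0 (submatrix_frame hY i) h1 (col_orth hY i) (col_nsq hY i) (by linarith)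
    have h3 := ae_ne_zero_of_lintegral_inv (by fun_prop) h2
    filter_upwards [hν.ae, h1, h3] with P hP hd hs
    exact (schur_vec hP.1 Y i hd hs).1

lemma RP.L2 {ν : Measure (Matrix ι ι K)} {k : ℕ} (hν : RP ν k) {Y : Matrix ι κ K} (hY : Yᴴ * Y = 1)
    (hk : (Fintype.card κ : ℝ) + alphaK K < k) :
    ∫⁻ P, ENNReal.ofReal (RCLike.re ((Yᴴ * P * Y)⁻¹.trace)) ∂ν ≤
      ENNReal.ofReal (Fintype.card κ + Fintype.card κ * ((Fintype.card ι : ℝ) - k) / (k - Fintype.card κ - alphaK K)) := by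
  have hkd : (k : ℝ) ≤ Fintype.card ι := by exact_mod_cast hν.k_le
  have hd := fun i => hν.L1 _ _ _ (submatrix_frame hY i) rfl (by rw [card_ne i]; linarith)
  have h2 := fun i => hν.L0 (submatrix_frame hY i) (hd i) (col_orth hY i) (col_nsq hY i) (by rw [card_ne i]; linarith)
  have h3 := fun i => ae_ne_zero_of_lintegral_inv (by fun_prop) (h2 i)
  have hd' := ae_all_iff.2 hd
  have h3' := ae_all_iff.2 h3
  calc _ ≤ ∫⁻ P, ∑ i : κ, (ENNReal.ofReal (nsq (Sc P (Y.submatrix id (Subtype.val : {j : κ // j ≠ i} → κ)) *ᵥ fun a => Y a i)))⁻¹ ∂ν := by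
        refine lintegral_mono_ae ?_
        filter_upwards [hν.ae, hd', h3'] with P hP h4 h5
        rw [trace, map_sum]
        refine (le_of_eq (ENNReal.ofReal_sum_of_nonneg ?_)).trans (Finset.sum_le_sum fun i _ => ?_)
        · intro i _
          rw [diag, (schur_vec hP.1 Y i (h4 i) (h5 i)).2, RCLike.ofReal_re]
          exact inv_nonneg.2 (nsq_nonneg _)
        · rw [diag, (schur_vec hP.1 Y i (h4 i) (h5 i)).2, RCLike.ofReal_re, ENNReal.ofReal_inv_of_pos]
          exact lt_of_le_of_ne (nsq_nonneg _) (Ne.symm (h5 i))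
    _ ≤ ∑ i : κ, ENNReal.ofReal (1 + ((Fintype.card ι : ℝ) - k) / (k - Fintype.card κ - alphaK K)) := by
        rw [lintegral_finsetSum _ (fun i _ => by fun_prop)]
        refine Finset.sum_le_sum fun i _ => (h2 i).trans (le_of_eq ?_)
        rw [card_ne i]
        congr 3
        ring
    _ = _ := by
        rw [Finset.sum_const, nsmul_eq_mul, ← ENNReal.ofReal_natCast, ← ENNReal.ofReal_mul (by positivity)]
        simp only [Finset.card_univ]
        congr 1; ring

end rp
end


noncomputable section
section rp
variable {K : Type*} [RCLike K] [MeasurableSpace K] [BorelSpace K]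
variable {ι κ τ σ ρ : Type*} [Fintype ι] [Fintype κ] [Fintype τ] [Fintype σ] [Fintype ρ] [DecidableEq ι] [DecidableEq κ] [DecidableEq τ] [DecidableEq σ] [DecidableEq ρ]

lemma frobSq_cols (M : Matrix ι κ K) : frobSq M = ∑ j, nsq (fun i => M i j) := by
  unfold frobSq nsq; rw [Finset.sum_comm]

lemma ofReal_frobSq_cols (M : Matrix ι κ K) : ENNReal.ofReal (frobSq M) = ∑ j, ENNReal.ofReal (nsq (fun i => M i j)) := by
  rw [frobSq_cols, ENNReal.ofReal_sum_of_nonneg (fun i _ => nsq_nonneg _)]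

lemma ofReal_frobSq_mul (G : Matrix σ ι K) (M : Matrix ι κ K) :
    ENNReal.ofReal (frobSq (G * M)) = ∑ j, ENNReal.ofReal (nsq (G *ᵥ (fun i => M i j))) := by
  rw [ofReal_frobSq_cols]; rfl

lemma orth_col {Y : Matrix ι κ K} {V : Matrix ι τ K} (h : Yᴴ * V = 0) (j : τ) : Yᴴ *ᵥ (fun i => V i j) = 0 := by
  ext i; exact congrFun (congrFun h i) j

lemma RP.avg {ν : Measure (Matrix ι ι K)} {k : ℕ} (hν : RP ν k) {Y : Matrix ι κ K} (hY : Yᴴ * Y = 1)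
    {V : Matrix ι τ K} (hV : Vᴴ * V = 1) (hYV : Yᴴ * V = 0) (hτ : 0 < Fintype.card τ)
    (G : Matrix ι ι K → Matrix σ ι K) (hG : Measurable G)
    (hinv : ∀ U : Matrix ι ι K, Uᴴ * U = 1 → U * Uᴴ = 1 → U * Y = Y → ∀ P b, nsq (G (U * P * Uᴴ) *ᵥ (U *ᵥ b)) = nsq (G P *ᵥ b))
    (c : ℝ) (hc : ∫⁻ P, ENNReal.ofReal (frobSq (G P * V)) ∂ν ≤ ENNReal.ofReal c)
    (b : ι → K) (hb : Yᴴ *ᵥ b = 0) :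
    ∫⁻ P, ENNReal.ofReal (nsq (G P *ᵥ b)) ∂ν ≤ ENNReal.ofReal (c / Fintype.card τ) * ENNReal.ofReal (nsq b) := by
  have h1 : ∀ j, ∫⁻ P, ENNReal.ofReal (nsq (G P *ᵥ b)) ∂ν =
      ENNReal.ofReal (nsq b) * ∫⁻ P, ENNReal.ofReal (nsq (G P *ᵥ (fun i => V i j))) ∂ν := by
    intro j
    rw [← lintegral_const_mul _ (by fun_prop)]
    rw [hν.rot_eq hY (fun P b => ENNReal.ofReal (nsq (G P *ᵥ b))) (fun b => by fun_prop) ?_ b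
      ((Real.sqrt (nsq b) : K) • (fun i => V i j)) hb ?_ ?_]
    · refine lintegral_congr fun P => ?_
      rw [mulVec_smul, nsq_smul, RCLike.norm_ofReal, sq_abs, Real.sq_sqrt (nsq_nonneg b), ENNReal.ofReal_mul (nsq_nonneg b)]
    · intro U u1 u2 u3 P b
      rw [hinv U u1 u2 u3]
    · rw [mulVec_smul, orth_col hYV j, smul_zero]
    · rw [nsq_smul, RCLike.norm_ofReal, sq_abs, Real.sq_sqrt (nsq_nonneg b), col_nsq hV j, mul_one]
  have h2 : (Fintype.card τ : ℝ≥0∞) * ∫⁻ P, ENNReal.ofReal (nsq (G P *ᵥ b)) ∂ν =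
      ENNReal.ofReal (nsq b) * ∫⁻ P, ENNReal.ofReal (frobSq (G P * V)) ∂ν := by
    simp_rw [ofReal_frobSq_mul]
    rw [lintegral_finsetSum _ (fun i _ => by fun_prop), Finset.mul_sum, ← Finset.sum_congr rfl (fun j _ => h1 j)]
    simp
  have hne : (Fintype.card τ : ℝ≥0∞) ≠ 0 := by exact_mod_cast hτ.ne'
  rw [← ENNReal.mul_le_mul_iff_right hne (by simp), h2, ← mul_assoc, mul_comm]
  gcongr
  refine hc.trans (le_of_eq ?_)
  rw [← ENNReal.ofReal_natCast, ← ENNReal.ofReal_mul (by positivity)]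
  congr 1
  have : (Fintype.card τ : ℝ) ≠ 0 := by exact_mod_cast hτ.ne'
  field_simp

lemma RP.avgMat {ν : Measure (Matrix ι ι K)} {k : ℕ} (hν : RP ν k) {Y : Matrix ι κ K} (hY : Yᴴ * Y = 1)
    {V : Matrix ι τ K} (hV : Vᴴ * V = 1) (hYV : Yᴴ * V = 0) (hτ : 0 < Fintype.card τ)
    (G : Matrix ι ι K → Matrix σ ι K) (hG : Measurable G)
    (hinv : ∀ U : Matrix ι ι K, Uᴴ * U = 1 → U * Uᴴ = 1 → U * Y = Y → ∀ P b, nsq (G (U * P * Uᴴ) *ᵥ (U *ᵥ b)) = nsq (G P *ᵥ b))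
    (c : ℝ) (hc : ∫⁻ P, ENNReal.ofReal (frobSq (G P * V)) ∂ν ≤ ENNReal.ofReal c)
    (B : Matrix ι ρ K) (hb : Yᴴ * B = 0) :
    ∫⁻ P, ENNReal.ofReal (frobSq (G P * B)) ∂ν ≤ ENNReal.ofReal (c / Fintype.card τ) * ENNReal.ofReal (frobSq B) := by
  simp_rw [ofReal_frobSq_mul, ofReal_frobSq_cols B]
  rw [lintegral_finsetSum _ (fun i _ => by fun_prop), Finset.mul_sum]
  exact Finset.sum_le_sum fun j _ => hν.avg hY hV hYV hτ G hG hinv c hc _ (orth_col hb j)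

lemma frobSq_CYPV {P : Matrix ι ι K} (hP : IsOP P) {Y : Matrix ι κ K} (hY : Yᴴ * Y = 1) {V : Matrix ι τ K}
    (hYV : Y * Yᴴ + V * Vᴴ = 1) (hd : IsUnit (Yᴴ * P * Y).det) :
    frobSq ((Yᴴ * P * Y)⁻¹ * Yᴴ * P * V) = RCLike.re ((Yᴴ * P * Y)⁻¹.trace) - Fintype.card κ := by
  have hC : ((Yᴴ * P * Y)⁻¹)ᴴ = (Yᴴ * P * Y)⁻¹ := by
    rw [conjTranspose_nonsing_inv]; simp only [conjTranspose_mul, hP.1, conjTranspose_conjTranspose, Matrix.mul_assoc]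
  have hV : V * Vᴴ = 1 - Y * Yᴴ := by rw [← hYV]; abel
  rw [frobSq_eq_re']
  have : (Yᴴ * P * Y)⁻¹ * Yᴴ * P * V * ((Yᴴ * P * Y)⁻¹ * Yᴴ * P * V)ᴴ = (Yᴴ * P * Y)⁻¹ - 1 := by
    set C := (Yᴴ * P * Y)⁻¹ with hCd
    have a1 : C * (Yᴴ * P * Y) = 1 := nonsing_inv_mul _ hd
    have a2 : (Yᴴ * P * Y) * C = 1 := mul_nonsing_inv _ hd
    calc _ = C * Yᴴ * P * (V * Vᴴ) * P * Y * C := by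
          simp only [conjTranspose_mul, hP.1, conjTranspose_conjTranspose, hC, Matrix.mul_assoc]
      _ = C * (Yᴴ * (P * P) * Y * C) - (C * (Yᴴ * P * Y)) * ((Yᴴ * P * Y) * C) := by
          rw [hV]; simp only [Matrix.mul_sub, Matrix.sub_mul, Matrix.mul_one, Matrix.mul_assoc]
      _ = _ := by rw [hP.2, a2, a1]; simp
  rw [this, trace_sub, trace_one]
  simp

lemma frobSq_ScV {P : Matrix ι ι K} (hP : IsOP P) {Y : Matrix ι κ K} {V : Matrix ι τ K} (hVV : Vᴴ * V = 1)
    (hYV : Y * Yᴴ + V * Vᴴ = 1) (hd : IsUnit (Yᴴ * P * Y).det) {k : ℕ} (ht : P.trace = (k : K)) :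
    frobSq ((1 - Sc P Y) * V) = Fintype.card τ - (k - Fintype.card κ) := by
  have hop := (Sc_isOP hP hd).compl
  have hV : V * Vᴴ = 1 - Y * Yᴴ := by rw [← hYV]; abel
  rw [frobSq_eq_re, conjTranspose_mul, hop.1, Matrix.mul_assoc, ← Matrix.mul_assoc (1 - Sc P Y), hop.2, trace_mul_comm,
    Matrix.mul_assoc, Matrix.sub_mul, Matrix.one_mul, trace_sub, trace_frame V hVV, hV, Matrix.mul_sub, ← Matrix.mul_assoc, Sc_mul_Y hd,
    Matrix.zero_mul, sub_zero, Matrix.mul_one, Sc_trace hP hd, ht]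
  simp

lemma RP.U1 {ν : Measure (Matrix ι ι K)} {k : ℕ} (hν : RP ν k) {Y : Matrix ι κ K} (hY : Yᴴ * Y = 1)
    (hk : (Fintype.card κ : ℝ) + alphaK K < k) (B : Matrix ι ρ K) (hB : Yᴴ * B = 0) :
    ∫⁻ P, ENNReal.ofReal (frobSq ((Yᴴ * P * Y)⁻¹ * Yᴴ * P * B)) ∂ν ≤
      ENNReal.ofReal ((((Fintype.card ι : ℝ) - k) / (Fintype.card ι - Fintype.card κ)) *
        (Fintype.card κ / (k - Fintype.card κ - alphaK K))) * ENNReal.ofReal (frobSq B) := by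
  have := hν.prob
  have hα := alphaK_nonneg (K := K)
  have hkd : (k : ℝ) ≤ Fintype.card ι := by exact_mod_cast hν.k_le
  obtain ⟨V, v1, v2, v3⟩ := exists_compl_frame Y hY
  have hcard : ((Fintype.card ι - Fintype.card κ : ℕ) : ℝ) = (Fintype.card ι : ℝ) - Fintype.card κ := Nat.cast_sub (card_le_of_frame Y hY)
  have hpos : 0 < ((Fintype.card ι - Fintype.card κ : ℕ) : ℝ) := by rw [hcard]; linarith
  have hdet := hν.L1 _ _ Y hY rfl hk
  have hpos2 : 0 < (k : ℝ) - Fintype.card κ - alphaK K := by linarith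
  have key := hν.avgMat hY v1 v3 (by simpa using (by exact_mod_cast hpos : 0 < Fintype.card ι - Fintype.card κ))
    (fun P => (Yᴴ * P * Y)⁻¹ * Yᴴ * P) (by fun_prop) ?_ (Fintype.card κ * ((Fintype.card ι : ℝ) - k) / (k - Fintype.card κ - alphaK K)) ?_ B hB
  · refine key.trans (le_of_eq ?_)
    congr 2
    rw [Fintype.card_fin, hcard]
    rw [hcard] at hpos
    field_simp
  · intro U u1 u2 u3 P b
    obtain ⟨a, _, c⟩ := gram_rot u1 u3 P
    rw [c, Matrix.mul_assoc, a, mulVec_mulVec]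
    congr 2
    simp only [Matrix.mul_assoc, u1, Matrix.mul_one]
  · have h1 := hν.L2 hY hk
    have e : ∫⁻ P, ENNReal.ofReal (RCLike.re ((Yᴴ * P * Y)⁻¹.trace)) ∂ν =
        ENNReal.ofReal (Fintype.card κ) + ∫⁻ P, ENNReal.ofReal (frobSq ((Yᴴ * P * Y)⁻¹ * Yᴴ * P * V)) ∂ν := by
      calc _ = ∫⁻ P, (ENNReal.ofReal (Fintype.card κ) + ENNReal.ofReal (frobSq ((Yᴴ * P * Y)⁻¹ * Yᴴ * P * V))) ∂ν := by
            refine lintegral_congr_ae ?_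
            filter_upwards [hν.ae, hdet] with P hP hd
            rw [← ENNReal.ofReal_add (by positivity) (frobSq_nonneg _), frobSq_CYPV hP.1 hY v2 hd]
            congr 1; ring
        _ = _ := by rw [lintegral_add_left (by fun_prop)]; simp
    rw [e, ENNReal.ofReal_add (by positivity) (div_nonneg (mul_nonneg (by positivity) (by linarith)) hpos2.le)] at h1
    exact (ENNReal.add_le_add_iff_left (by simp)).1 h1

lemma RP.U2 {ν : Measure (Matrix ι ι K)} {k : ℕ} (hν : RP ν k) {Y : Matrix ι κ K} (hY : Yᴴ * Y = 1)
    (hk : (Fintype.card κ : ℝ) + alphaK K < k) (B : Matrix ι ρ K) (hB : Yᴴ * B = 0) :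
    ∫⁻ P, ENNReal.ofReal (frobSq ((1 - Sc P Y) * B)) ∂ν ≤
      ENNReal.ofReal (((Fintype.card ι : ℝ) - k) / (Fintype.card ι - Fintype.card κ)) * ENNReal.ofReal (frobSq B) := by
  have := hν.prob
  have hα := alphaK_nonneg (K := K)
  have hkd : (k : ℝ) ≤ Fintype.card ι := by exact_mod_cast hν.k_le
  obtain ⟨V, v1, v2, v3⟩ := exists_compl_frame Y hY
  have hcard : ((Fintype.card ι - Fintype.card κ : ℕ) : ℝ) = (Fintype.card ι : ℝ) - Fintype.card κ := Nat.cast_sub (card_le_of_frame Y hY)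
  have hpos : 0 < ((Fintype.card ι - Fintype.card κ : ℕ) : ℝ) := by rw [hcard]; linarith
  have hdet := hν.L1 _ _ Y hY rfl hk
  have key := hν.avgMat hY v1 v3 (by simpa using (by exact_mod_cast hpos : 0 < Fintype.card ι - Fintype.card κ))
    (fun P => 1 - Sc P Y) (by fun_prop) ?_ ((Fintype.card ι : ℝ) - k) ?_ B hB
  · refine key.trans (le_of_eq ?_)
    rw [Fintype.card_fin, hcard]
  · intro U u1 u2 u3 P b
    rw [Sc_rot u1 u3, mulVec_mulVec]
    have : (1 - U * Sc P Y * Uᴴ) * U = U * (1 - Sc P Y) := by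
      simp only [Matrix.sub_mul, Matrix.mul_sub, Matrix.mul_assoc, u1, Matrix.mul_one, Matrix.one_mul]
    rw [this, ← mulVec_mulVec, nsq_isom U u1]
  · calc _ = ∫⁻ P, ENNReal.ofReal ((Fintype.card ι : ℝ) - k) ∂ν := by
            refine lintegral_congr_ae ?_
            filter_upwards [hν.ae, hdet] with P hP hd
            rw [frobSq_ScV hP.1 v1 v2 hd hP.2, Fintype.card_fin, hcard]
            congr 1; ring
        _ ≤ _ := by simp

end rp
end


noncomputable section
section ga
variable {K : Type*} [RCLike K] [MeasurableSpace K] [BorelSpace K]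
variable {ι κ τ σ ρ : Type*} [Fintype ι] [Fintype κ] [Fintype τ] [Fintype σ] [Fintype ρ] [DecidableEq ι] [DecidableEq κ] [DecidableEq τ] [DecidableEq σ] [DecidableEq ρ]

/-- matrix with given columns -/
def colM {K : Type*} {κ σ : Type*} (x : κ → σ → K) : Matrix σ κ K := Matrix.of fun s j => x j s

@[fun_prop]
lemma Measurable.colM' {X : Type*} [MeasurableSpace X] {f : X → κ → σ → K} (hf : Measurable f) : Measurable fun x => colM (f x) := by
  refine measurable_mat fun i j => ?_
  exact (measurable_pi_apply i).comp ((measurable_pi_apply j).comp hf)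

lemma isOP_one : IsOP (1 : Matrix σ σ K) := ⟨by simp, by simp⟩

lemma mp_restrict (i : κ) : MeasurePreserving (fun (x : κ → σ → K) (j : {j : κ // j ≠ i}) => x j) (gm K κ σ) (gm K {j : κ // j ≠ i} σ) := by
  have mp := measurePreserving_piEquivPiSubtypeProd (fun _ : κ => gvec K σ) (fun j => j ≠ i)
  exact measurePreserving_fst.comp mp

lemma gm_split (i : κ) (F : ({j : κ // j ≠ i} → σ → K) → (σ → K) → ℝ≥0∞) (hF : Measurable fun z : _ × _ => F z.1 z.2) :
    ∫⁻ x, F (fun j => x j) (x i) ∂(gm K κ σ) = ∫⁻ y, ∫⁻ g, F y g ∂(gvec K σ) ∂(gm K {j : κ // j ≠ i} σ) := by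
  have mp := measurePreserving_piEquivPiSubtypeProd (fun _ : κ => gvec K σ) (fun j => j ≠ i)
  have hm : Measurable fun z : ({j : κ // j ≠ i} → σ → K) × ({j : κ // ¬ j ≠ i} → σ → K) => F z.1 (z.2 ⟨i, by simp⟩) :=
    hF.comp (f := fun z : ({j : κ // j ≠ i} → σ → K) × ({j : κ // ¬ j ≠ i} → σ → K) => (z.1, z.2 ⟨i, by simp⟩)) (by fun_prop)
  have h5 := mp.lintegral_comp hm
  refine Eq.trans h5 ?_
  rw [lintegral_prod _ hm.aemeasurable]
  refine lintegral_congr fun y => ?_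
  have h6 := (measurePreserving_eval (fun _ : {j : κ // ¬ j ≠ i} => gvec K σ) ⟨i, by simp⟩).lintegral_comp
    (f := fun g => F y g) (hF.comp (f := fun g => (y, g)) (by fun_prop))
  exact h6

lemma meas_key (i : κ) : Measurable fun x : κ → σ → K => nsq (Sc 1 ((colM x).submatrix id (Subtype.val : {j : κ // j ≠ i} → κ)) *ᵥ fun a => colM x a i) := by
  have : Measurable fun x : κ → σ → K => nsq (Sc 1 (colM fun j : {j : κ // j ≠ i} => x j.1) *ᵥ (x i)) := by fun_prop
  exact this

lemma meas_gm (W : Matrix ι τ K) : Measurable (fun (x : ι → σ → K) (j : τ) (s : σ) => ∑ i, star (x i s) * W i j) := by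
  refine measurable_pi_lambda _ fun j => measurable_pi_lambda _ fun s => Finset.measurable_sum _ fun i _ => ?_
  have h : Measurable fun x : ι → σ → K => x i s := by fun_prop
  exact (continuous_star.measurable.comp h).mul_const (W i j)

lemma gauss_L0 (i : κ) (hk : (Fintype.card κ : ℝ) + alphaK K < Fintype.card σ)
    (hd : ∀ᵐ y ∂(gm K {j : κ // j ≠ i} σ), IsUnit ((colM y)ᴴ * (1 : Matrix σ σ K) * colM y).det) :
    ∫⁻ x, (ENNReal.ofReal (nsq (Sc 1 ((colM x).submatrix id (Subtype.val : {j : κ // j ≠ i} → κ)) *ᵥ fun a => colM x a i)))⁻¹ ∂(gm K κ σ)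
      ≤ ENNReal.ofReal (1 / (Fintype.card σ - Fintype.card κ - alphaK K)) := by
  have h1 := gm_split (K := K) (σ := σ) i (fun y g => (ENNReal.ofReal (nsq (Sc 1 (colM y) *ᵥ g)))⁻¹) (by fun_prop)
  refine (le_of_eq h1).trans ?_
  have hα := alphaK_nonneg (K := K)
  have hc := card_ne (κ := κ) i
  have hle : Fintype.card {j : κ // j ≠ i} ≤ Fintype.card σ := by
    have : (Fintype.card {j : κ // j ≠ i} : ℝ) ≤ Fintype.card σ := by linarith
    exact_mod_cast this
  calc _ ≤ ∫⁻ y, ENNReal.ofReal (1 / (Fintype.card σ - Fintype.card κ - alphaK K)) ∂(gm K {j : κ // j ≠ i} σ) := by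
        refine lintegral_mono_ae ?_
        filter_upwards [hd] with y hy
        have := lintegral_inv_proj (Sc_isOP isOP_one hy) (Fintype.card σ - Fintype.card {j : κ // j ≠ i})
          (by rw [Sc_trace isOP_one hy, trace_one, Nat.cast_sub hle]) (by rw [Nat.cast_sub hle]; linarith)
        refine this.trans (le_of_eq ?_)
        rw [Nat.cast_sub hle, hc]
        congr 2
        ring
    _ = _ := by simp

lemma gauss_L1 : ∀ (m : ℕ) (κ : Type*) [Fintype κ] [DecidableEq κ]
    (_ : Fintype.card κ = m) (_ : (Fintype.card κ : ℝ) + alphaK K < Fintype.card σ),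
    ∀ᵐ x ∂(gm K κ σ), IsUnit ((colM x)ᴴ * (1 : Matrix σ σ K) * colM x).det := by
  intro m
  induction m with
  | zero =>
    intro κ _ _ hc _
    have : IsEmpty κ := Fintype.card_eq_zero_iff.1 hc
    simp [det_isEmpty]
  | succ m ih =>
    intro κ _ _ hc hk
    have hne : Nonempty κ := Fintype.card_pos_iff.1 (by omega)
    obtain ⟨i⟩ := hne
    have hci := card_ne (κ := κ) i
    have h1 := ih {j : κ // j ≠ i} (by
      rw [hc] at hci; push_cast at hci
      have : (Fintype.card {j : κ // j ≠ i} : ℝ) = m := by linarith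
      exact_mod_cast this) (by linarith)
    have h2 := gauss_L0 i hk h1
    have h3 := ae_ne_zero_of_lintegral_inv (meas_key i) h2
    have h1' := (mp_restrict (K := K) (σ := σ) i).quasiMeasurePreserving.ae h1
    filter_upwards [h1', h3] with x hd hs
    exact (schur_vec isOP_one (colM x) i hd hs).1

lemma gauss_L2 (hk : (Fintype.card κ : ℝ) + alphaK K < Fintype.card σ) :
    ∫⁻ x, ENNReal.ofReal (RCLike.re (((colM x)ᴴ * (1 : Matrix σ σ K) * colM x)⁻¹.trace)) ∂(gm K κ σ) ≤
      ENNReal.ofReal (Fintype.card κ / (Fintype.card σ - Fintype.card κ - alphaK K)) := by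
  have hd := fun i : κ => gauss_L1 (K := K) (σ := σ) _ {j : κ // j ≠ i} rfl (by rw [card_ne i]; linarith)
  have h2 := fun i => gauss_L0 (K := K) i hk (hd i)
  have hmm : ∀ i : κ, _ := fun i => meas_key (K := K) (σ := σ) i
  have h3 := fun i => ae_ne_zero_of_lintegral_inv (hmm i) (h2 i)
  have hd' := ae_all_iff.2 fun i => (mp_restrict (K := K) (σ := σ) i).quasiMeasurePreserving.ae (hd i)
  have h3' := ae_all_iff.2 h3
  calc _ ≤ ∫⁻ x, ∑ i : κ, (ENNReal.ofReal (nsq (Sc 1 ((colM x).submatrix id (Subtype.val : {j : κ // j ≠ i} → κ)) *ᵥ fun a => colM x a i)))⁻¹ ∂(gm K κ σ) := by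
        refine lintegral_mono_ae ?_
        filter_upwards [hd', h3'] with x h4 h5
        rw [trace, map_sum]
        refine (le_of_eq (ENNReal.ofReal_sum_of_nonneg ?_)).trans (Finset.sum_le_sum fun i _ => ?_)
        · intro i _
          rw [diag, (schur_vec isOP_one (colM x) i (h4 i) (h5 i)).2, RCLike.ofReal_re]
          exact inv_nonneg.2 (nsq_nonneg _)
        · rw [diag, (schur_vec isOP_one (colM x) i (h4 i) (h5 i)).2, RCLike.ofReal_re, ENNReal.ofReal_inv_of_pos]
          exact lt_of_le_of_ne (nsq_nonneg _) (Ne.symm (h5 i))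
    _ ≤ ∑ i : κ, ENNReal.ofReal (1 / (Fintype.card σ - Fintype.card κ - alphaK K)) := by
        refine (le_of_eq (lintegral_finsetSum _ (fun i _ => (hmm i).ennreal_ofReal.inv))).trans ?_
        exact Finset.sum_le_sum fun i _ => (h2 i)
    _ = _ := by
        rw [Finset.sum_const, nsmul_eq_mul, ← ENNReal.ofReal_natCast, ← ENNReal.ofReal_mul (by positivity)]
        simp only [Finset.card_univ]
        congr 1; ring

lemma lintegral_nsq_linear (G : Matrix κ σ K) : ∫⁻ g, ENNReal.ofReal (nsq (G *ᵥ g)) ∂(gvec K σ) = ENNReal.ofReal (frobSq G) := by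
  unfold nsq frobSq
  simp_rw [fun g : σ → K => ENNReal.ofReal_sum_of_nonneg (s := Finset.univ) (f := fun i => ‖(G *ᵥ g) i‖ ^ 2) (fun i _ => by positivity)]
  rw [ENNReal.ofReal_sum_of_nonneg (fun i _ => by positivity), lintegral_finsetSum]
  · exact Finset.sum_congr rfl fun i _ => lintegral_linear_gvec (G i)
  · intro i _
    have : Measurable fun g : σ → K => (G *ᵥ g) i := (measurable_pi_apply i).comp (measurable_mulVec G)
    fun_prop

lemma frobSq_CM {M : Matrix σ κ K} (hd : IsUnit (Mᴴ * M).det) :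
    frobSq ((Mᴴ * M)⁻¹ * Mᴴ) = RCLike.re ((Mᴴ * M)⁻¹.trace) := by
  rw [frobSq_eq_re', conjTranspose_mul, conjTranspose_conjTranspose, conjTranspose_nonsing_inv, conjTranspose_mul, conjTranspose_conjTranspose,
    Matrix.mul_assoc, ← Matrix.mul_assoc Mᴴ, mul_nonsing_inv _ hd, Matrix.mul_one]

lemma gauss_ae {Y : Matrix ι κ K} (hY : Yᴴ * Y = 1) (hk : (Fintype.card κ : ℝ) + alphaK K < Fintype.card σ) :
    ∀ᵐ Ψ : Matrix ι σ K ∂(gm K ι σ), IsUnit ((Ψᴴ * Y)ᴴ * (Ψᴴ * Y)).det := by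
  have h1 := gauss_L1 (K := K) (σ := σ) _ κ rfl hk
  rw [← gm_map Y hY] at h1
  have h2 := ae_of_ae_map (f := fun (x : ι → σ → K) (j : κ) (s : σ) => ∑ i, star (x i s) * Y i j) (meas_gm Y).aemeasurable h1
  simp_rw [Matrix.mul_one] at h2
  exact h2

lemma gauss_unit {Y : Matrix ι κ K} (hY : Yᴴ * Y = 1) (hk : (Fintype.card κ : ℝ) + alphaK K < Fintype.card σ)
    {u : ι → K} (hu : Yᴴ *ᵥ u = 0) (hu1 : nsq u = 1) :
    ∫⁻ Ψ : Matrix ι σ K, ENNReal.ofReal (nsq ((((Ψᴴ * Y)ᴴ * (Ψᴴ * Y))⁻¹ * (Ψᴴ * Y)ᴴ) *ᵥ (Ψᴴ *ᵥ u))) ∂(gm K ι σ) ≤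
      ENNReal.ofReal (Fintype.card κ / (Fintype.card σ - Fintype.card κ - alphaK K)) := by
  have hW := frame_extend hY hu hu1
  set W : Matrix ι (κ ⊕ Unit) K := fromCols Y (replicateCol Unit u) with hWd
  let H : (κ → σ → K) × (Unit → σ → K) → ℝ≥0∞ := fun z =>
    ENNReal.ofReal (nsq ((((colM z.1)ᴴ * (colM z.1))⁻¹ * (colM z.1)ᴴ) *ᵥ (z.2 ())))
  have hH : Measurable H := by unfold H; fun_prop
  let H' : (κ ⊕ Unit → σ → K) → ℝ≥0∞ := fun x => H (fun j => x (Sum.inl j), fun j => x (Sum.inr j))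
  have hH' : Measurable H' := hH.comp (f := fun x : κ ⊕ Unit → σ → K => (fun j => x (Sum.inl j), fun j => x (Sum.inr j))) (by fun_prop)
  have e1 : ∫⁻ Ψ : Matrix ι σ K, ENNReal.ofReal (nsq ((((Ψᴴ * Y)ᴴ * (Ψᴴ * Y))⁻¹ * (Ψᴴ * Y)ᴴ) *ᵥ (Ψᴴ *ᵥ u))) ∂(gm K ι σ) =
      ∫⁻ x, H' x ∂(gm K (κ ⊕ Unit) σ) := by
    rw [← gm_map W hW, lintegral_map hH' (meas_gm W)]
    rfl
  have mp := measurePreserving_sumPiEquivProdPi (X := fun _ : κ ⊕ Unit => σ → K) (fun _ => gvec K σ)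
  have e2 : ∫⁻ x, H' x ∂(gm K (κ ⊕ Unit) σ) = ∫⁻ z, H z ∂((gm K κ σ).prod (gm K Unit σ)) := mp.lintegral_comp hH
  rw [e1, e2, lintegral_prod _ hH.aemeasurable]
  calc _ = ∫⁻ x, ENNReal.ofReal (RCLike.re (((colM x)ᴴ * (1 : Matrix σ σ K) * colM x)⁻¹.trace)) ∂(gm K κ σ) := by
        refine lintegral_congr_ae ?_
        filter_upwards [gauss_L1 (K := K) (σ := σ) _ κ rfl hk] with x hx
        rw [Matrix.mul_one] at hx ⊢
        rw [← frobSq_CM hx, ← lintegral_nsq_linear]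
        exact (measurePreserving_eval (fun _ : Unit => gvec K σ) ()).lintegral_comp
          (f := fun g => ENNReal.ofReal (nsq ((((colM x)ᴴ * (colM x))⁻¹ * (colM x)ᴴ) *ᵥ g))) (by fun_prop)
    _ ≤ _ := gauss_L2 hk

lemma gauss_U3 {Y : Matrix ι κ K} (hY : Yᴴ * Y = 1) (hk : (Fintype.card κ : ℝ) + alphaK K < Fintype.card σ)
    (B : Matrix ι ρ K) (hB : Yᴴ * B = 0) :
    ∫⁻ Ψ : Matrix ι σ K, ENNReal.ofReal (frobSq ((((Ψᴴ * Y)ᴴ * (Ψᴴ * Y))⁻¹ * (Ψᴴ * Y)ᴴ * Ψᴴ) * B)) ∂(gm K ι σ) ≤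
      ENNReal.ofReal (Fintype.card κ / (Fintype.card σ - Fintype.card κ - alphaK K)) * ENNReal.ofReal (frobSq B) := by
  have hid : Measurable (fun Ψ : ι → σ → K => (Matrix.of Ψ : Matrix ι σ K)) := measurable_id
  have hmv : ∀ b : ι → K, Measurable fun Ψ : ι → σ → K => ENNReal.ofReal (nsq (((((of Ψ)ᴴ * Y)ᴴ * ((of Ψ)ᴴ * Y))⁻¹ * ((of Ψ)ᴴ * Y)ᴴ * (of Ψ)ᴴ) *ᵥ b)) := by
    intro b; fun_prop
  simp_rw [ofReal_frobSq_mul, ofReal_frobSq_cols B]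
  refine (le_of_eq (lintegral_finsetSum _ (fun j _ => hmv (fun i => B i j)))).trans ?_
  rw [Finset.mul_sum]
  refine Finset.sum_le_sum fun j _ => ?_
  have hb := orth_col hB j
  generalize (fun i => B i j) = b at hb ⊢
  by_cases h0 : nsq b = 0
  · rw [nsq_eq_zero] at h0
    subst h0
    simp [nsq]
  set N : ℝ := Real.sqrt (nsq b) with hN
  have hNN : N ^ 2 = nsq b := Real.sq_sqrt (nsq_nonneg b)
  have hN0 : N ≠ 0 := by intro h; rw [h] at hNN; exact h0 (by rw [← hNN]; norm_num)
  have hNK : (N : K) ≠ 0 := by exact_mod_cast hN0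
  have n1 : nsq ((N : K)⁻¹ • b) = 1 := by
    rw [nsq_smul, ← hNN, norm_inv, RCLike.norm_ofReal, inv_pow, sq_abs]
    field_simp
  have key := gauss_unit (σ := σ) hY hk (u := (N : K)⁻¹ • b) (by rw [mulVec_smul, hb, smul_zero]) n1
  rw [mul_comm]
  refine le_trans (le_of_eq ?_) (mul_le_mul_right key (ENNReal.ofReal (nsq b)))
  refine Eq.trans ?_ (lintegral_const_mul' _ _ (by simp))
  refine lintegral_congr fun Ψ => ?_
  rw [mulVec_smul, mulVec_smul, nsq_smul, norm_inv, RCLike.norm_ofReal, inv_pow, sq_abs, hNN, ← ENNReal.ofReal_mul (nsq_nonneg b), mulVec_mulVec]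
  congr 1
  field_simp
  rfl

end ga
end


noncomputable section
section det
variable {K : Type*} [RCLike K]
variable {ι κ τ σ ρ : Type*} [Fintype ι] [Fintype κ] [Fintype τ] [Fintype σ] [Fintype ρ] [DecidableEq ι] [DecidableEq κ] [DecidableEq τ] [DecidableEq σ] [DecidableEq ρ]

lemma gram_unit_of_inj {M : Matrix ι κ K} (h : ∀ v, M *ᵥ v = 0 → v = 0) : IsUnit (Mᴴ * M).det := by
  rw [isUnit_iff_ne_zero]
  intro h0
  obtain ⟨v, hv, h1⟩ := Matrix.exists_mulVec_eq_zero_iff.2 h0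
  rw [conjTranspose_mul_self_mulVec_eq_zero] at h1
  exact hv (h v h1)

lemma inj_of_gram_unit {M : Matrix ι κ K} (h : IsUnit (Mᴴ * M).det) (v : κ → K) (hv : M *ᵥ v = 0) : v = 0 := by
  by_contra h0
  have := Matrix.exists_mulVec_eq_zero_iff.1 ⟨v, h0, show (Mᴴ * M) *ᵥ v = 0 by rw [← mulVec_mulVec, hv, mulVec_zero]⟩
  rw [this] at h
  simp at h

lemma gram_unit_of_rank {M : Matrix ι κ K} (h : M.rank = Fintype.card κ) : IsUnit (Mᴴ * M).det := by
  rw [← rank_conjTranspose_mul_self] at h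
  rw [← Matrix.isUnit_iff_isUnit_det]
  rw [← Matrix.mulVec_surjective_iff_isUnit]
  have h2 : LinearMap.range ((Mᴴ * M).mulVecLin) = ⊤ := by
    apply Submodule.eq_top_of_finrank_eq
    rw [← Matrix.rank, h]; simp
  intro y
  have : y ∈ LinearMap.range ((Mᴴ * M).mulVecLin) := by rw [h2]; trivial
  exact this

lemma gram_herm (M : Matrix ι κ K) : ((Mᴴ * M)⁻¹)ᴴ = (Mᴴ * M)⁻¹ := by
  rw [conjTranspose_nonsing_inv]; simp

/-- orthogonal projector onto the range -/
def projM (M : Matrix ι κ K) : Matrix ι ι K := M * (Mᴴ * M)⁻¹ * Mᴴ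

lemma projM_mul {M : Matrix ι κ K} (h : IsUnit (Mᴴ * M).det) : projM M * M = M := by
  unfold projM
  rw [Matrix.mul_assoc, Matrix.mul_assoc, Matrix.nonsing_inv_mul _ h, Matrix.mul_one]

lemma projM_herm (M : Matrix ι κ K) : (projM M)ᴴ = projM M := by
  unfold projM
  simp only [conjTranspose_mul, gram_herm, conjTranspose_conjTranspose, Matrix.mul_assoc]

lemma projM_isOP {M : Matrix ι κ K} (h : IsUnit (Mᴴ * M).det) : IsOP (projM M) := by
  refine ⟨projM_herm M, ?_⟩
  conv_lhs => enter [2]; unfold projM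
  rw [← Matrix.mul_assoc, ← Matrix.mul_assoc, projM_mul h]; rfl

lemma projM_trace {M : Matrix ι κ K} (h : IsUnit (Mᴴ * M).det) : (projM M).trace = (Fintype.card κ : K) := by
  unfold projM
  rw [trace_mul_comm, ← Matrix.mul_assoc, Matrix.mul_nonsing_inv _ h, trace_one]

lemma projM_rot {U : Matrix ι ι K} (hU : Uᴴ * U = 1) (M : Matrix ι κ K) : projM (U * M) = U * projM M * Uᴴ := by
  unfold projM
  have : (U * M)ᴴ * (U * M) = Mᴴ * M := by
    rw [conjTranspose_mul, Matrix.mul_assoc, ← Matrix.mul_assoc Uᴴ, hU, Matrix.one_mul]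
  rw [this, conjTranspose_mul]
  simp only [Matrix.mul_assoc]

lemma exists_orth {m : ℕ} {Y0 : Matrix ι (Fin m) K} (h : IsUnit (Y0ᴴ * Y0).det) :
    ∃ (Y : Matrix ι (Fin m) K) (R : Matrix (Fin m) (Fin m) K), Yᴴ * Y = 1 ∧ Y * Yᴴ = projM Y0 ∧ Y0 = Y * R ∧ IsUnit R.det := by
  obtain ⟨Y, h1, h2⟩ := (projM_isOP h).exists_frame_of_trace m (by rw [projM_trace h]; simp)
  have h3 : Y0 = Y * (Yᴴ * Y0) := by rw [← Matrix.mul_assoc, h2, projM_mul h]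
  refine ⟨Y, Yᴴ * Y0, h1, h2, h3, ?_⟩
  have h4 : (Yᴴ * Y0)ᴴ * (Yᴴ * Y0) = Y0ᴴ * Y0 := by
    rw [conjTranspose_mul, conjTranspose_conjTranspose, Matrix.mul_assoc, ← h3]
  rw [← h4, det_mul] at h
  exact isUnit_of_mul_isUnit_right h

lemma mp_unique {M : Matrix ι κ K} (h : IsUnit (Mᴴ * M).det) {X : Matrix κ ι K} (hX : IsMoorePenrose M X) :
    X = (Mᴴ * M)⁻¹ * Mᴴ := by
  obtain ⟨h1, h2, h3, h4⟩ := hX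
  have : Mᴴ * M * X = Mᴴ := by
    rw [Matrix.mul_assoc, ← h3, ← conjTranspose_mul, h1]
  have h5 : (Mᴴ * M)⁻¹ * (Mᴴ * M * X) = X := Matrix.nonsing_inv_mul_cancel_left _ _ h
  rw [this] at h5
  exact h5.symm

lemma det_red {Y0 : Matrix ι κ K} {Y : Matrix ι κ K} {R : Matrix κ κ K} (hY : Yᴴ * Y = 1) (hR : IsUnit R.det) (hYR : Y0 = Y * R)
    (Ψ : Matrix ι σ K) (hN : IsUnit ((Ψᴴ * Y)ᴴ * (Ψᴴ * Y)).det) (A : Matrix ι τ K) :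
    IsUnit ((Ψᴴ * Y0)ᴴ * (Ψᴴ * Y0)).det ∧
    frobSq (A - Y0 * (((Ψᴴ * Y0)ᴴ * (Ψᴴ * Y0))⁻¹ * (Ψᴴ * Y0)ᴴ * (Ψᴴ * A))) =
      frobSq ((1 - Y * Yᴴ) * A) + frobSq ((((Ψᴴ * Y)ᴴ * (Ψᴴ * Y))⁻¹ * (Ψᴴ * Y)ᴴ * Ψᴴ) * ((1 - Y * Yᴴ) * A)) := by
  set N := Ψᴴ * Y with hNd
  have e1 : Ψᴴ * Y0 = N * R := by rw [hYR, hNd, Matrix.mul_assoc]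
  have e2 : (N * R)ᴴ * (N * R) = Rᴴ * ((Nᴴ * N) * R) := by simp only [conjTranspose_mul, Matrix.mul_assoc]
  have hR' : IsUnit (Rᴴ).det := by rw [det_conjTranspose]; exact hR.star
  rw [e1]
  constructor
  · rw [e2, det_mul, det_mul]; exact hR'.mul (hN.mul hR)
  · have e3 : R * (((N * R)ᴴ * (N * R))⁻¹ * (N * R)ᴴ) = (Nᴴ * N)⁻¹ * Nᴴ := by
      rw [e2, Matrix.mul_inv_rev, Matrix.mul_inv_rev, conjTranspose_mul N R]
      have : R * (R⁻¹ * (Nᴴ * N)⁻¹ * Rᴴ⁻¹ * (Rᴴ * Nᴴ)) = (R * R⁻¹) * (Nᴴ * N)⁻¹ * ((Rᴴ⁻¹ * Rᴴ) * Nᴴ) := by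
        simp only [Matrix.mul_assoc]
      rw [this, Matrix.mul_nonsing_inv _ hR, Matrix.nonsing_inv_mul _ hR']; simp
    set B := (1 - Y * Yᴴ) * A with hB
    have hA : A = B + Y * (Yᴴ * A) := by
      rw [hB, Matrix.sub_mul, Matrix.one_mul, Matrix.mul_assoc]; abel
    have hYB : Yᴴ * B = 0 := by
      rw [hB, ← Matrix.mul_assoc, Matrix.mul_sub, ← Matrix.mul_assoc, hY]; simp
    have e4 : Y0 * (((N * R)ᴴ * (N * R))⁻¹ * (N * R)ᴴ * (Ψᴴ * A)) = Y * ((Nᴴ * N)⁻¹ * Nᴴ * Ψᴴ * B) + Y * (Yᴴ * A) := by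
      have : Y0 * (((N * R)ᴴ * (N * R))⁻¹ * (N * R)ᴴ * (Ψᴴ * A)) = Y * ((R * (((N * R)ᴴ * (N * R))⁻¹ * (N * R)ᴴ)) * (Ψᴴ * A)) := by
        rw [hYR]; simp only [Matrix.mul_assoc]
      rw [this, e3, ← Matrix.mul_add]
      congr 1
      conv_lhs => rw [hA]
      rw [Matrix.mul_add, Matrix.mul_add, ← Matrix.mul_assoc Ψᴴ Y, ← hNd, ← Matrix.mul_assoc _ N, Matrix.mul_assoc _ Nᴴ N,
        Matrix.nonsing_inv_mul _ hN, Matrix.one_mul]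
      simp only [Matrix.mul_assoc]
    have e5 : A - Y0 * (((N * R)ᴴ * (N * R))⁻¹ * (N * R)ᴴ * (Ψᴴ * A)) = B - Y * ((Nᴴ * N)⁻¹ * Nᴴ * Ψᴴ * B) := by
      rw [e4]
      conv_lhs => enter [1]; rw [hA]
      abel
    rw [e5, frobSq_sub, frobSq_isom _ hY]
    rw [← Matrix.mul_assoc]
    have : Bᴴ * Y = 0 := by rw [← conjTranspose_conjTranspose Y, ← conjTranspose_mul, hYB, conjTranspose_zero]
    rw [this, Matrix.zero_mul]

lemma exists_range_frame (H : Matrix ι τ K) :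
    ∃ V : Matrix ι (Fin H.rank) K, Vᴴ * V = 1 ∧ V * (Vᴴ * H) = H := by
  let S : Submodule K (EuclideanSpace K ι) := LinearMap.range (Matrix.toEuclideanLin H)
  have hS : Module.finrank K S = H.rank := by
    rw [Matrix.rank_eq_finrank_range_toLin H (EuclideanSpace.basisFun ι K).toBasis (EuclideanSpace.basisFun τ K).toBasis]
    rfl
  let b : OrthonormalBasis (Fin H.rank) K S := (stdOrthonormalBasis K S).reindex (finCongr hS)
  refine ⟨Matrix.of fun i j => (b j : EuclideanSpace K ι) i, ?_, ?_⟩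
  · ext i j
    have h := b.orthonormal
    rw [orthonormal_iff_ite] at h
    have h2 := h i j
    rw [one_apply, ← h2]
    simp only [mul_apply, conjTranspose_apply, of_apply]
    rw [Submodule.coe_inner, PiLp.inner_apply]
    refine Finset.sum_congr rfl fun x _ => ?_
    simp [mul_comm]
  · set V : Matrix ι _ K := Matrix.of fun i j => (b j : EuclideanSpace K ι) i with hV
    ext i j
    let y : EuclideanSpace K ι := WithLp.toLp 2 (fun i => H i j)
    have hy : y ∈ S := ⟨EuclideanSpace.single j 1, by
      ext i; simp [y, Matrix.toEuclideanLin]⟩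
    have := b.sum_repr' ⟨y, hy⟩
    have h3 := congrArg (fun z : S => (z : EuclideanSpace K ι) i) this
    simp only [Submodule.coe_sum, Submodule.coe_smul] at h3
    have h4 : ((⟨y, hy⟩ : S) : EuclideanSpace K ι) i = H i j := rfl
    rw [← h4, ← h3, mul_apply]
    rw [WithLp.ofLp_sum, Finset.sum_apply]
    refine Finset.sum_congr rfl fun x _ => ?_
    rw [WithLp.ofLp_smul, Pi.smul_apply, smul_eq_mul, mul_comm]
    simp only [V, of_apply]
    congr 1
    rw [Submodule.coe_inner, PiLp.inner_apply, mul_apply]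
    refine Finset.sum_congr rfl fun z _ => ?_
    simp [y, mul_comm]

/-- row-space frame: `A V Vᴴ = A`. -/
lemma exists_row_frame (A : Matrix ι τ K) :
    ∃ V : Matrix τ (Fin A.rank) K, Vᴴ * V = 1 ∧ A * V * Vᴴ = A := by
  obtain ⟨V, h1, h2⟩ := exists_range_frame Aᴴ
  have key : ∀ m, m = Aᴴ.rank → ∃ V : Matrix τ (Fin m) K, Vᴴ * V = 1 ∧ A * V * Vᴴ = A := by
    rintro m rfl
    refine ⟨V, h1, ?_⟩
    have := congrArg conjTranspose h2
    simpa only [conjTranspose_mul, conjTranspose_conjTranspose] using this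
  exact key _ (rank_conjTranspose A).symm

lemma row_frame_inj {A : Matrix ι τ K} {V : Matrix τ (Fin A.rank) K} (h2 : A * V * Vᴴ = A) :
    IsUnit ((A * V)ᴴ * (A * V)).det := by
  apply gram_unit_of_rank
  apply le_antisymm
  · exact rank_le_card_width _
  · rw [Fintype.card_fin]
    conv_lhs => rw [← h2]
    exact rank_mul_le_left _ _

/-- deterministic Ω step, on the compressed space -/
lemma omega_step {P : Matrix ι ι K} (hP : IsOP P) {Y : Matrix ι κ K} (hY : Yᴴ * Y = 1) (hd : IsUnit (Yᴴ * P * Y).det)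
    (A' : Matrix τ ι K) (Q : Matrix τ τ K) (hQ : IsOP Q) (hQP : Q * (A' * P) = 0) :
    frobSq (Q * A') ≤ frobSq ((1 - Sc P Y) * ((1 - Y * Yᴴ) * A'ᴴ)) +
      frobSq ((Yᴴ * P * Y)⁻¹ * Yᴴ * P * ((1 - Y * Yᴴ) * A'ᴴ)) := by
  set C := (Yᴴ * P * Y)⁻¹ with hC
  set S := Sc P Y with hS
  set B := (1 - Y * Yᴴ) * A'ᴴ with hB
  have hSY : S * Y = 0 := Sc_mul_Y hd
  have hYS : Yᴴ * S = 0 := Y_mul_Sc hP hd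
  have hSs : Sᴴ = S := Sc_conjTranspose hP
  have hSS := (Sc_isOP hP hd)
  have hPS : P * S = S := mul_Sc hP
  have hCs : Cᴴ = C := by
    rw [hC, conjTranspose_nonsing_inv]; simp [conjTranspose_mul, hP.1, Matrix.mul_assoc]
  set Z := P * Y * C * Yᴴ + S with hZ
  have hPZ : P * Z = Z := by
    rw [hZ, Matrix.mul_add, hPS]; simp only [← Matrix.mul_assoc, hP.2]
  have hYZ : Yᴴ * Z = Yᴴ := by
    rw [hZ, Matrix.mul_add, hYS, add_zero]
    simp only [← Matrix.mul_assoc]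
    rw [Matrix.mul_nonsing_inv _ hd, Matrix.one_mul]
  have hYB : Yᴴ * B = 0 := by
    rw [hB, ← Matrix.mul_assoc, Matrix.mul_sub, ← Matrix.mul_assoc, hY]; simp
  have hBs : Bᴴ = A' * (1 - Y * Yᴴ) := by
    rw [hB]; simp [conjTranspose_mul]
  have e1 : Q * A' = Q * (Bᴴ * (1 - Z)) := by
    rw [hBs, Matrix.mul_assoc A', Matrix.mul_sub (1 - Y * Yᴴ), Matrix.sub_mul _ _ Z, Matrix.one_mul, Matrix.mul_one, Matrix.mul_assoc Y, hYZ]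
    have : 1 - Y * Yᴴ - (Z - Y * Yᴴ) = 1 - Z := by abel
    rw [this, Matrix.mul_sub, Matrix.mul_sub, Matrix.mul_one, ← hPZ, ← Matrix.mul_assoc A', ← Matrix.mul_assoc Q, hQP]; simp
  rw [e1]
  refine (frobSq_proj_le Q hQ _).trans (le_of_eq ?_)
  rw [← frobSq_conjTranspose]
  have e2 : (Bᴴ * (1 - Z))ᴴ = (1 - S) * B - Y * (C * Yᴴ * P * B) := by
    rw [hZ]
    simp only [conjTranspose_mul, conjTranspose_sub, conjTranspose_add, conjTranspose_one, conjTranspose_conjTranspose, hSs, hCs, hP.1]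
    simp only [Matrix.sub_mul, Matrix.add_mul, Matrix.one_mul, Matrix.mul_assoc]
    abel
  rw [e2, frobSq_sub, frobSq_isom _ hY]
  have : ((1 - S) * B)ᴴ * Y = 0 := by
    rw [← conjTranspose_conjTranspose Y, ← conjTranspose_mul, ← Matrix.mul_assoc, Matrix.mul_sub, hYS]
    simp [hYB]
  rw [← Matrix.mul_assoc, this, Matrix.zero_mul]

/-- compression of a full-rank embedding is full rank -/
lemma compress_inj {Om : Matrix ι κ K} (hO : IsUnit (Omᴴ * Om).det) {V : Matrix ι ρ K} {V' : Matrix ι σ K}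
    (h2 : V * Vᴴ + V' * V'ᴴ = 1) (hd : IsUnit (V'ᴴ * (1 - projM Om) * V').det) :
    IsUnit ((Vᴴ * Om)ᴴ * (Vᴴ * Om)).det := by
  apply gram_unit_of_inj
  intro v hv
  apply inj_of_gram_unit hO
  set w := Om *ᵥ v with hw
  have h3 : Vᴴ *ᵥ w = 0 := by rw [hw, mulVec_mulVec]; exact hv
  have h4 : V' *ᵥ (V'ᴴ *ᵥ w) = w := by
    have : (V * Vᴴ + V' * V'ᴴ) *ᵥ w = w := by rw [h2, one_mulVec]
    rw [add_mulVec, ← mulVec_mulVec, h3, mulVec_zero, zero_add, ← mulVec_mulVec] at this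
    exact this
  have h5 : (1 - projM Om) *ᵥ w = 0 := by
    rw [sub_mulVec, one_mulVec, hw, mulVec_mulVec, projM_mul hO, sub_self]
  have h6 : (V'ᴴ * (1 - projM Om) * V') *ᵥ (V'ᴴ *ᵥ w) = 0 := by
    rw [← mulVec_mulVec, h4, ← mulVec_mulVec, h5, mulVec_zero]
  have h7 : V'ᴴ *ᵥ w = 0 := by
    by_contra h0
    have := Matrix.exists_mulVec_eq_zero_iff.1 ⟨_, h0, h6⟩
    rw [this] at hd; simp at hd
  rw [← h4, h7, mulVec_zero]

lemma gram_unit_mul {G : Matrix ι κ K} {M : Matrix κ τ K} (hG : IsUnit (Gᴴ * G).det) (hM : IsUnit (Mᴴ * M).det) :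
    IsUnit ((G * M)ᴴ * (G * M)).det := by
  apply gram_unit_of_inj
  intro v hv
  apply inj_of_gram_unit hM
  apply inj_of_gram_unit hG
  rw [mulVec_mulVec, hv]

/-- frame of the row space of the best approximation -/
lemma best_frame {A Aq : Matrix ι τ K} {V : Matrix τ ρ K} (hV : Vᴴ * V = 1) :
    ∃ (q' : ℕ) (Y : Matrix ρ (Fin q') K), q' ≤ Aq.rank ∧ Yᴴ * Y = 1 ∧
      frobSq ((1 - Y * Yᴴ) * (A * V)ᴴ) ≤ frobSq (A - Aq) := by
  obtain ⟨Y, h1, h2⟩ := exists_row_frame (Aq * V)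
  refine ⟨_, Y, rank_mul_le_left _ _, h1, ?_⟩
  have e1 : (1 - Y * Yᴴ) * (A * V)ᴴ = (1 - Y * Yᴴ) * ((A - Aq) * V)ᴴ := by
    rw [Matrix.sub_mul A, conjTranspose_sub, Matrix.mul_sub (1 - Y * Yᴴ)]
    have : (1 - Y * Yᴴ) * (Aq * V)ᴴ = 0 := by
      have h3 := congrArg conjTranspose h2
      rw [conjTranspose_mul, conjTranspose_mul, conjTranspose_conjTranspose] at h3
      rw [Matrix.sub_mul, Matrix.one_mul, Matrix.mul_assoc, h3, sub_self]
    rw [this, sub_zero]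
  rw [e1]
  refine (frobSq_proj_le _ (isOP_frame Y h1).compl _).trans ?_
  rw [conjTranspose_mul, ← frobSq_isom V hV, ← Matrix.mul_assoc]
  refine (frobSq_proj_le _ (isOP_frame V hV) _).trans ?_
  rw [frobSq_conjTranspose]
end det
end


noncomputable section
section fin
variable {K : Type*} [RCLike K] [MeasurableSpace K] [BorelSpace K]
variable {ι κ τ σ ρ : Type*} [Fintype ι] [Fintype κ] [Fintype τ] [Fintype σ] [Fintype ρ] [DecidableEq ι] [DecidableEq κ] [DecidableEq τ] [DecidableEq σ] [DecidableEq ρ]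

@[fun_prop]
lemma Measurable.projM' {X : Type*} [MeasurableSpace X] {f : X → Matrix ι κ K} (hf : Measurable f) :
    Measurable fun x => projM (f x) := by
  unfold projM; fun_prop

lemma measurableSet_mat_eq {X : Type*} [MeasurableSpace X] {f g : X → Matrix ι κ K} (hf : Measurable f) (hg : Measurable g) :
    MeasurableSet {x | f x = g x} := by
  have : {x | f x = g x} = ⋂ i, ⋂ j, {x | f x i j = g x i j} := by
    ext x
    simp only [Set.mem_ofPred_eq, Set.mem_iInter]
    exact Matrix.ext_iff.symm
  rw [this]
  exact MeasurableSet.iInter fun i => MeasurableSet.iInter fun j => measurableSet_eq_fun (hf.matEntry i j) (hg.matEntry i j)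

lemma measurableSet_op (k : ℕ) : MeasurableSet {P : Matrix ι ι K | IsOP P ∧ P.trace = (k : K)} := by
  have h1 : MeasurableSet {P : Matrix ι ι K | Pᴴ = P} := measurableSet_mat_eq (by fun_prop) (by fun_prop)
  have h2 : MeasurableSet {P : Matrix ι ι K | P * P = P} := measurableSet_mat_eq (by fun_prop) (by fun_prop)
  have h3 : MeasurableSet {P : Matrix ι ι K | P.trace = (k : K)} := by
    refine measurableSet_eq_fun ?_ measurable_const
    unfold Matrix.trace
    exact Finset.measurable_sum _ fun i _ => Measurable.matEntry measurable_id i i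
  exact (h1.inter h2).inter h3

lemma measurableSet_unit {X : Type*} [MeasurableSpace X] {f : X → Matrix ι ι K} (hf : Measurable f) :
    MeasurableSet {x | IsUnit (f x).det} := by
  simp only [isUnit_iff_ne_zero]
  exact (measurableSet_eq_fun hf.matDet measurable_const).compl

lemma RP_of_map {lam : Measure (Matrix ι κ K)} [IsProbabilityMeasure lam]
    (hinv : ∀ U : Matrix ι ι K, Uᴴ * U = 1 → U * Uᴴ = 1 → Measure.map (fun M => U * M) lam = lam)
    {F : Matrix ι κ K → Matrix ι ι K} (hF : Measurable F)
    (hFU : ∀ U : Matrix ι ι K, Uᴴ * U = 1 → U * Uᴴ = 1 → ∀ M, F (U * M) = U * F M * Uᴴ) {k : ℕ}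
    (hae : ∀ᵐ M ∂lam, IsOP (F M) ∧ (F M).trace = (k : K)) : RP (Measure.map F lam) k := by
  refine ⟨Measure.isProbabilityMeasure_map hF.aemeasurable, ?_, ?_⟩
  · exact (ae_map_iff hF.aemeasurable (measurableSet_op k)).2 hae
  · intro U h1 h2
    rw [Measure.map_map (by fun_prop) hF]
    conv_rhs => rw [← hinv U h1 h2, Measure.map_map hF (by fun_prop)]
    congr 1
    ext1 M
    exact (hFU U h1 h2 M).symm

lemma compress_inv {lam : Measure (Matrix ι κ K)}
    (hinv : ∀ U : Matrix ι ι K, Uᴴ * U = 1 → U * Uᴴ = 1 → Measure.map (fun M => U * M) lam = lam)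
    {V : Matrix ι ρ K} (hV : Vᴴ * V = 1) (U : Matrix ρ ρ K) (hU1 : Uᴴ * U = 1) (hU2 : U * Uᴴ = 1) :
    Measure.map (fun M => U * M) (Measure.map (fun M => Vᴴ * M) lam) = Measure.map (fun M => Vᴴ * M) lam := by
  obtain ⟨W, w1, w2, w3⟩ := exists_unitary_transport V (V * Uᴴ) hV (by
    rw [conjTranspose_mul, Matrix.mul_assoc, ← Matrix.mul_assoc Vᴴ, hV, Matrix.one_mul, conjTranspose_conjTranspose, hU2])
  have e : Vᴴ * Wᴴ = U * Vᴴ := by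
    rw [← conjTranspose_mul, w3, conjTranspose_mul, conjTranspose_conjTranspose]
  rw [Measure.map_map (by fun_prop) (by fun_prop)]
  conv_rhs => rw [← hinv Wᴴ (by rw [conjTranspose_conjTranspose]; exact w2) (by rw [conjTranspose_conjTranspose]; exact w1), Measure.map_map (by fun_prop) (by fun_prop)]
  congr 1
  ext1 M
  simp only [Function.comp]
  rw [← Matrix.mul_assoc, ← Matrix.mul_assoc, e]

/-- What we need about the law of `Ψ`. -/
def PsiGood (nu : Measure (Matrix ι σ K)) (m : ℕ) (τ : Type*) [Fintype τ] (c : ℝ) : Prop :=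
  ∀ Y : Matrix ι (Fin m) K, Yᴴ * Y = 1 →
    (∀ᵐ Ψ ∂nu, IsUnit ((Ψᴴ * Y)ᴴ * (Ψᴴ * Y)).det) ∧
    ∀ B : Matrix ι τ K, Yᴴ * B = 0 →
      ∫⁻ Ψ, ENNReal.ofReal (frobSq ((((Ψᴴ * Y)ᴴ * (Ψᴴ * Y))⁻¹ * (Ψᴴ * Y)ᴴ * Ψᴴ) * B)) ∂nu ≤
        ENNReal.ofReal c * ENNReal.ofReal (frobSq B)

lemma psiGood_gauss (d k m : ℕ) (hk : (m : ℝ) + alphaK K < k) :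
    PsiGood (K := K) (gaussianMatrix K d k) m τ (1 * ((m : ℝ) / (k - m - alphaK K))) := by
  intro Y hY
  rw [gaussianMatrix_eq]
  constructor
  · exact gauss_ae hY (by simpa using hk)
  · intro B hB
    have := gauss_U3 (σ := Fin k) hY (by simpa using hk) B hB
    simp only [Fintype.card_fin] at this
    rw [one_mul]
    exact this

lemma psiGood_orth {d k : ℕ} {nu : Measure (Matrix (Fin d) (Fin k) K)} [IsProbabilityMeasure nu]
    (hinv : ∀ U : Matrix (Fin d) (Fin d) K, Uᴴ * U = 1 → U * Uᴴ = 1 → Measure.map (fun M => U * M) nu = nu)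
    (ho : ∀ᵐ M ∂nu, Mᴴ * M = 1) (m : ℕ) (hk : (m : ℝ) + alphaK K < k) :
    PsiGood (K := K) nu m τ (((d : ℝ) - k) / (d - m) * ((m : ℝ) / (k - m - alphaK K))) := by
  have hF : Measurable fun Ψ : Matrix (Fin d) (Fin k) K => Ψ * Ψᴴ := by fun_prop
  have hRP : RP (Measure.map (fun Ψ : Matrix (Fin d) (Fin k) K => Ψ * Ψᴴ) nu) k := by
    refine RP_of_map hinv hF ?_ ?_
    · intro U _ _ M
      simp only [conjTranspose_mul, Matrix.mul_assoc]
    · filter_upwards [ho] with M hM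
      exact ⟨isOP_frame M hM, by rw [trace_frame M hM]; simp⟩
  intro Y hY
  have e : ∀ Ψ : Matrix (Fin d) (Fin k) K, (Ψᴴ * Y)ᴴ * (Ψᴴ * Y) = Yᴴ * (Ψ * Ψᴴ) * Y := by
    intro Ψ; simp only [conjTranspose_mul, conjTranspose_conjTranspose, Matrix.mul_assoc]
  constructor
  · have := ae_of_ae_map hF.aemeasurable (hRP.L1 _ _ Y hY rfl (by simpa using hk))
    filter_upwards [this] with Ψ h
    rw [e]; exact h
  · intro B hB
    have := hRP.U1 hY (by simpa using hk) B hB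
    rw [lintegral_map (by fun_prop) hF] at this
    simp only [Fintype.card_fin] at this
    refine le_of_eq_of_le (lintegral_congr fun Ψ => ?_) this
    rw [e]
    simp only [conjTranspose_mul, conjTranspose_conjTranspose, Matrix.mul_assoc]

lemma coef_mono {r l q q' a : ℝ} (hl : l < r) (hq : q < l - a) (ha : 0 ≤ a) (h0 : 0 ≤ q') (h : q' ≤ q) :
    (r - l) / (r - q') * (q' / (l - q' - a)) + (r - l) / (r - q') ≤ (r - l) / (r - q) * (1 + q / (l - q - a)) := by
  have e : (r - l) / (r - q') * (q' / (l - q' - a)) + (r - l) / (r - q') = (r - l) / (r - q') * (1 + q' / (l - q' - a)) := by ring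
  rw [e]
  have h1 : 0 < r - q := by linarith
  have h2 : 0 < l - q - a := by linarith
  have h3 : 0 ≤ r - l := by linarith
  have h4 : 0 ≤ l - q' - a := by linarith
  have h5 : 0 ≤ r - q := h1.le
  have h6 : 0 ≤ q := by linarith
  gcongr

lemma omega_bound {n m : ℕ} (hmn : m ≤ n) {lam : Measure (Matrix (Fin n) (Fin m) K)} [IsProbabilityMeasure lam]
    (hinv : ∀ U : Matrix (Fin n) (Fin n) K, Uᴴ * U = 1 → U * Uᴴ = 1 → Measure.map (fun M => U * M) lam = lam)
    (hfull : ∀ᵐ M ∂lam, IsUnit (Mᴴ * M).det) (A Aq : Matrix ι (Fin n) K) (hr : (m : ℝ) + alphaK K < A.rank)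
    (q : ℕ) (hq : (q : ℝ) < (m : ℝ) - alphaK K) (hAq : Aq.rank ≤ q) :
    (∀ᵐ M ∂lam, IsUnit ((A * M)ᴴ * (A * M)).det) ∧
    ∫⁻ M, ENNReal.ofReal (frobSq ((1 - projM (A * M)) * A)) ∂lam ≤
      ENNReal.ofReal (((A.rank : ℝ) - m) / (A.rank - q) * (1 + (q : ℝ) / (m - q - alphaK K))) * ENNReal.ofReal (frobSq (A - Aq)) := by
  have hα := alphaK_nonneg (K := K)
  obtain ⟨V, hV, hAV⟩ := exists_row_frame A
  have hG := row_frame_inj hAV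
  obtain ⟨V', v1, v2, v3⟩ := exists_compl_frame V hV
  have hrn : A.rank ≤ n := by simpa using rank_le_card_width A
  -- complement projector
  have hRP1 : RP (Measure.map (fun M : Matrix (Fin n) (Fin m) K => 1 - projM M) lam) (n - m) := by
    refine RP_of_map hinv (by fun_prop) ?_ ?_
    · intro U h1 h2 M
      rw [projM_rot h1, Matrix.mul_sub, Matrix.sub_mul, Matrix.mul_one, h2]
    · filter_upwards [hfull] with M hM
      refine ⟨(projM_isOP hM).compl, ?_⟩
      rw [trace_sub, projM_trace hM, trace_one, Nat.cast_sub hmn]; simp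
  have hcomp : ∀ᵐ M ∂lam, IsUnit ((Vᴴ * M)ᴴ * (Vᴴ * M)).det := by
    have := ae_of_ae_map (by fun_prop) (hRP1.L1 _ _ V' v1 rfl (by
      simp only [Fintype.card_fin]
      rw [Nat.cast_sub hrn, Nat.cast_sub hmn]; linarith))
    filter_upwards [this, hfull] with M h1 h2
    exact compress_inj h2 v2 h1
  have hAM : ∀ M : Matrix (Fin n) (Fin m) K, A * M = (A * V) * (Vᴴ * M) := by
    intro M
    conv_lhs => rw [← hAV]
    simp only [Matrix.mul_assoc]
  have hae : ∀ᵐ M ∂lam, IsUnit ((A * M)ᴴ * (A * M)).det := by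
    filter_upwards [hcomp] with M h
    rw [hAM]
    exact gram_unit_mul hG h
  refine ⟨hae, ?_⟩
  set lam' := Measure.map (fun M => Vᴴ * M) lam with hlam'
  have hp' : IsProbabilityMeasure lam' := Measure.isProbabilityMeasure_map (by fun_prop)
  have hRP : RP (Measure.map (fun M : Matrix (Fin A.rank) (Fin m) K => projM M) lam') m := by
    refine RP_of_map (compress_inv hinv hV) (by fun_prop) ?_ ?_
    · intro U h1 h2 M
      exact projM_rot h1 M
    · have : ∀ᵐ M ∂lam', IsUnit (Mᴴ * M).det :=
        (ae_map_iff (by fun_prop) (measurableSet_unit (by fun_prop))).2 hcomp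
      filter_upwards [this] with M hM
      exact ⟨projM_isOP hM, by rw [projM_trace hM]; simp⟩
  obtain ⟨q', Y, hq', hY, hbest⟩ := best_frame (A := A) (Aq := Aq) hV
  have hq'q : (q' : ℝ) ≤ q := by exact_mod_cast hq'.trans hAq
  set B := (1 - Y * Yᴴ) * (A * V)ᴴ with hB
  have hYB : Yᴴ * B = 0 := by
    rw [hB, ← Matrix.mul_assoc, Matrix.mul_sub, ← Matrix.mul_assoc, hY]; simp
  have hk : (Fintype.card (Fin q') : ℝ) + alphaK K < m := by simp only [Fintype.card_fin]; linarith
  have hU1 := hRP.U1 hY hk B hYB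
  have hU2 := hRP.U2 hY hk B hYB
  have hL1 := hRP.L1 _ _ Y hY rfl hk
  have hmp : Measurable fun M : Matrix (Fin A.rank) (Fin m) K => projM M := by fun_prop
  have hmv : Measurable fun M : Matrix (Fin n) (Fin m) K => Vᴴ * M := by fun_prop
  rw [lintegral_map (by fun_prop) hmp, hlam', lintegral_map (by fun_prop) hmv] at hU1 hU2
  have hL1' := ae_of_ae_map hmv.aemeasurable (ae_of_ae_map hmp.aemeasurable hL1)
  simp only [Fintype.card_fin] at hU1 hU2
  calc ∫⁻ M, ENNReal.ofReal (frobSq ((1 - projM (A * M)) * A)) ∂lam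
      ≤ ∫⁻ M, (ENNReal.ofReal (frobSq ((Yᴴ * projM (Vᴴ * M) * Y)⁻¹ * Yᴴ * projM (Vᴴ * M) * B)) +
          ENNReal.ofReal (frobSq ((1 - Sc (projM (Vᴴ * M)) Y) * B))) ∂lam := by
        refine lintegral_mono_ae ?_
        filter_upwards [hcomp, hae, hL1'] with M h1 h2 h3
        rw [← ENNReal.ofReal_add (frobSq_nonneg _) (frobSq_nonneg _)]
        refine ENNReal.ofReal_le_ofReal ?_
        have hQ := (projM_isOP h2).compl
        have hz : (1 - projM (A * M)) * (A * M) = 0 := by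
          rw [Matrix.sub_mul, projM_mul h2, Matrix.one_mul, sub_self]
        have hQP : (1 - projM (A * M)) * (A * V * projM (Vᴴ * M)) = 0 := by
          have : A * V * projM (Vᴴ * M) = A * M * (((Vᴴ * M)ᴴ * (Vᴴ * M))⁻¹ * (Vᴴ * M)ᴴ) := by
            unfold projM
            rw [← Matrix.mul_assoc, ← Matrix.mul_assoc, ← hAM]
            simp only [Matrix.mul_assoc]
          rw [this, ← Matrix.mul_assoc, hz, Matrix.zero_mul]
        have hstep := omega_step (projM_isOP h1) hY h3 (A * V) _ hQ hQP
        have e : frobSq ((1 - projM (A * M)) * A) = frobSq ((1 - projM (A * M)) * (A * V)) := by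
          conv_lhs => enter [1, 2]; rw [← hAV]
          rw [← frobSq_conjTranspose, ← Matrix.mul_assoc, conjTranspose_mul, conjTranspose_conjTranspose, frobSq_isom V hV, frobSq_conjTranspose]
        rw [e, add_comm]
        exact hstep
    _ ≤ _ := by
        rw [lintegral_add_left (by fun_prop)]
        refine (add_le_add hU1 hU2).trans ?_
        rw [← add_mul]
        have hnn1 : (0 : ℝ) ≤ ((A.rank : ℝ) - m) / (A.rank - q') := div_nonneg (by linarith) (by linarith)
        have hnn2 : (0 : ℝ) ≤ (q' : ℝ) / (m - q' - alphaK K) := div_nonneg (by positivity) (by linarith)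
        rw [← ENNReal.ofReal_add (mul_nonneg hnn1 hnn2) hnn1]
        gcongr
        exact coef_mono (by linarith) hq hα (by positivity) hq'q

/-- integrating out `Ψ` -/
lemma psi_step {m : ℕ} {nu : Measure (Matrix ι σ K)} [IsProbabilityMeasure nu] {c : ℝ} (hc : 0 ≤ c) (A : Matrix ι τ K)
    (hnu : PsiGood nu m τ c) (Y0 : Matrix ι (Fin m) K) (hY0 : IsUnit (Y0ᴴ * Y0).det) :
    (∀ᵐ Ψ ∂nu, IsUnit ((Ψᴴ * Y0)ᴴ * (Ψᴴ * Y0)).det) ∧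
    ∫⁻ Ψ, ENNReal.ofReal (frobSq (A - Y0 * (((Ψᴴ * Y0)ᴴ * (Ψᴴ * Y0))⁻¹ * (Ψᴴ * Y0)ᴴ * (Ψᴴ * A)))) ∂nu ≤
      ENNReal.ofReal (1 + c) * ENNReal.ofReal (frobSq ((1 - projM Y0) * A)) := by
  obtain ⟨Y, R, hY, hYp, hYR, hR⟩ := exists_orth hY0
  obtain ⟨h1, h2⟩ := hnu Y hY
  constructor
  · filter_upwards [h1] with Ψ h
    exact (det_red hY hR hYR Ψ h A).1
  · set B := (1 - projM Y0) * A with hB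
    have hYB : Yᴴ * B = 0 := by
      rw [hB, ← hYp, ← Matrix.mul_assoc, Matrix.mul_sub, ← Matrix.mul_assoc, hY]; simp
    have h3 := h2 B hYB
    calc _ = ∫⁻ Ψ, (ENNReal.ofReal (frobSq B) + ENNReal.ofReal (frobSq ((((Ψᴴ * Y)ᴴ * (Ψᴴ * Y))⁻¹ * (Ψᴴ * Y)ᴴ * Ψᴴ) * B))) ∂nu := by
          refine lintegral_congr_ae ?_
          filter_upwards [h1] with Ψ h
          rw [(det_red hY hR hYR Ψ h A).2, hYp, ENNReal.ofReal_add (frobSq_nonneg _) (frobSq_nonneg _)]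
      _ ≤ _ := by
          rw [lintegral_add_left (by fun_prop), lintegral_const, measure_univ, mul_one, ENNReal.ofReal_add zero_le_one hc, add_mul,
            ENNReal.ofReal_one, one_mul]
          gcongr
end fin
end

/-- **Generalized Nyström, sharp upper bound** (Theorem 4.1(a)): for independent
full-rank embeddings `Ω` (rotation-invariant) and `Ψ` (Gaussian with `γ = 1`, or random
orthonormal with `γ = (d − k)/(d − ℓ)`), with `ℓ + α_K < k`, and any `A` with
`r = rank A ≥ k`, `E‖A − A⟨Ω,Ψ⟩‖_F² ≤ (1 + γ ℓ/(k − ℓ − α_K)) ((r − ℓ)/(r − q))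
(1 + q/(ℓ − q − α_K)) ‖A − [A]_q‖_F²` for all `q < ℓ − α_K`. -/
theorem generalized_nystrom_upper_bound
    {K : Type*} [RCLike K] [MeasurableSpace K] [BorelSpace K]
    {Y : Type*} [MeasurableSpace Y] (μ : Measure Y) [IsProbabilityMeasure μ]
    (pinv : (m n : ℕ) → Matrix (Fin m) (Fin n) K → Matrix (Fin n) (Fin m) K)
    (hpinv : ∀ (m n : ℕ) (A : Matrix (Fin m) (Fin n) K), IsMoorePenrose A (pinv m n A))
    (n ℓ d k : ℕ) (hℓn : ℓ ≤ n) (hkd : k ≤ d)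
    (Om : Y → Matrix (Fin n) (Fin ℓ) K) (Psi : Y → Matrix (Fin d) (Fin k) K)
    (hOmMeas : Measurable Om) (hPsiMeas : Measurable Psi)
    (hOmFull : ∀ᵐ ω ∂μ, (Om ω).rank = ℓ)
    (hPsiFull : ∀ᵐ ω ∂μ, (Psi ω).rank = k)
    (hIndep : IndepFun Om Psi μ)
    (hOmRot : RotationInvariant μ Om)
    (γ : ℝ)
    (hPsi : (IsGaussianEmbedding μ Psi ∧ γ = 1) ∨
      (IsRandomOrthonormal μ Psi ∧ γ = ((d : ℝ) - (k : ℝ)) / ((d : ℝ) - (ℓ : ℝ))))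
    (hℓk : (ℓ : ℝ) + alphaK K < (k : ℝ))
    (A : Matrix (Fin d) (Fin n) K) (hrank : k ≤ A.rank) :
    ∀ (q : ℕ) (Aq : Matrix (Fin d) (Fin n) K),
      (q : ℝ) < (ℓ : ℝ) - alphaK K → IsBestRankApprox q A Aq →
      ∫ ω, frobSq (A - (A * Om ω) *
          (pinv k ℓ ((Psi ω)ᴴ * A * Om ω) * ((Psi ω)ᴴ * A))) ∂μ ≤
        (1 + γ * ((ℓ : ℝ) / ((k : ℝ) - (ℓ : ℝ) - alphaK K))) *
          (((A.rank : ℝ) - (ℓ : ℝ)) / ((A.rank : ℝ) - (q : ℝ)) *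
            ((1 + (q : ℝ) / ((ℓ : ℝ) - (q : ℝ) - alphaK K)) * frobSq (A - Aq))) := by
  intro q Aq hq hbest
  have hα := alphaK_nonneg (K := K)
  set F : Y → ℝ := fun ω => frobSq (A - (A * Om ω) *
          (pinv k ℓ ((Psi ω)ᴴ * A * Om ω) * ((Psi ω)ᴴ * A))) with hF
  have hkr : (k : ℝ) ≤ A.rank := by exact_mod_cast hrank
  have hkdR : (k : ℝ) ≤ d := by exact_mod_cast hkd
  have hγ0 : 0 ≤ γ := by
    rcases hPsi with ⟨_, h⟩ | ⟨_, h⟩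
    · rw [h]; exact zero_le_one
    · rw [h]; exact div_nonneg (by linarith) (by linarith)
  set c : ℝ := γ * ((ℓ : ℝ) / ((k : ℝ) - (ℓ : ℝ) - alphaK K)) with hc
  have hc0 : 0 ≤ c := mul_nonneg hγ0 (div_nonneg (by positivity) (by linarith))
  set C : ℝ := ((A.rank : ℝ) - (ℓ : ℝ)) / ((A.rank : ℝ) - (q : ℝ)) * (1 + (q : ℝ) / ((ℓ : ℝ) - (q : ℝ) - alphaK K)) with hC
  have hC0 : 0 ≤ C := mul_nonneg (div_nonneg (by linarith) (by linarith))
    (add_nonneg zero_le_one (div_nonneg (by positivity) (by linarith)))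
  have hfr := frobSq_nonneg (A - Aq)
  rw [← mul_assoc (((A.rank : ℝ) - (ℓ : ℝ)) / ((A.rank : ℝ) - (q : ℝ))), ← hC]
  have hR0 : 0 ≤ (1 + c) * (C * frobSq (A - Aq)) := mul_nonneg (by linarith) (mul_nonneg hC0 hfr)
  by_cases hIntg : Integrable F μ
  swap
  · rw [integral_undef hIntg]; exact hR0
  rw [← ENNReal.ofReal_le_ofReal_iff hR0,
    ofReal_integral_eq_lintegral_ofReal hIntg (Eventually.of_forall fun ω => frobSq_nonneg _)]
  -- laws
  set lam := Measure.map Om μ with hlam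
  set nu := Measure.map Psi μ with hnu
  have hp1 : IsProbabilityMeasure lam := Measure.isProbabilityMeasure_map hOmMeas.aemeasurable
  have hp2 : IsProbabilityMeasure nu := Measure.isProbabilityMeasure_map hPsiMeas.aemeasurable
  have hprod : Measure.map (fun ω => (Om ω, Psi ω)) μ = lam.prod nu :=
    (indepFun_iff_map_prod_eq_prod_map_map hOmMeas.aemeasurable hPsiMeas.aemeasurable).1 hIndep
  have hinv : ∀ U : Matrix (Fin n) (Fin n) K, Uᴴ * U = 1 → U * Uᴴ = 1 → Measure.map (fun M => U * M) lam = lam := by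
    intro U h1 h2
    rw [hlam, Measure.map_map (by fun_prop) hOmMeas]
    exact hOmRot U (Matrix.mem_unitaryGroup_iff.2 h2)
  have hfull : ∀ᵐ M ∂lam, IsUnit (Mᴴ * M).det := by
    rw [hlam, ae_map_iff hOmMeas.aemeasurable (measurableSet_unit (by fun_prop))]
    filter_upwards [hOmFull] with ω h
    exact gram_unit_of_rank (by simpa using h)
  have hgood : PsiGood nu ℓ (Fin n) c := by
    rcases hPsi with ⟨⟨_, h⟩, hg⟩ | ⟨⟨_, h, ho⟩, hg⟩
    · rw [hc, hg, hnu, h]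
      exact psiGood_gauss d k ℓ hℓk
    · rw [hc, hg]
      refine psiGood_orth ?_ ?_ ℓ hℓk
      · intro U h1 h2
        rw [hnu, Measure.map_map (by fun_prop) hPsiMeas]
        exact h U (Matrix.mem_unitaryGroup_iff.2 h2)
      · rw [hnu, ae_map_iff hPsiMeas.aemeasurable (measurableSet_mat_eq (by fun_prop) (by fun_prop))]
        exact ho
  obtain ⟨hO1, hO2⟩ := omega_bound hℓn hinv hfull A Aq (by linarith) q hq hbest.1
  set G : Matrix (Fin n) (Fin ℓ) K × Matrix (Fin d) (Fin k) K → ℝ≥0∞ := fun z =>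
    ENNReal.ofReal (frobSq (A - (A * z.1) * (((z.2ᴴ * (A * z.1))ᴴ * (z.2ᴴ * (A * z.1)))⁻¹ * (z.2ᴴ * (A * z.1))ᴴ * (z.2ᴴ * A)))) with hG
  have hGm : Measurable G := by rw [hG]; fun_prop
  have hunit : ∀ᵐ z ∂(lam.prod nu), IsUnit ((z.2ᴴ * (A * z.1))ᴴ * (z.2ᴴ * (A * z.1))).det := by
    rw [Measure.ae_prod_iff_ae_ae (measurableSet_unit (by fun_prop))]
    filter_upwards [hO1] with M hM
    exact (psi_step hc0 A hgood (A * M) hM).1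
  rw [← hprod] at hunit
  have hunit' := ae_of_ae_map (hOmMeas.prodMk hPsiMeas).aemeasurable hunit
  calc ∫⁻ ω, ENNReal.ofReal (F ω) ∂μ = ∫⁻ ω, G (Om ω, Psi ω) ∂μ := by
        refine lintegral_congr_ae ?_
        filter_upwards [hunit'] with ω h
        have := mp_unique h (hpinv k ℓ ((Psi ω)ᴴ * (A * Om ω)))
        rw [hF, hG]
        dsimp only
        rw [← this, Matrix.mul_assoc (Psi ω)ᴴ A]
    _ = ∫⁻ M, ∫⁻ Ψ, G (M, Ψ) ∂nu ∂lam := by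
        rw [← lintegral_prod _ hGm.aemeasurable, ← hprod, lintegral_map hGm (hOmMeas.prodMk hPsiMeas)]
    _ ≤ ∫⁻ M, ENNReal.ofReal (1 + c) * ENNReal.ofReal (frobSq ((1 - projM (A * M)) * A)) ∂lam := by
        refine lintegral_mono_ae ?_
        filter_upwards [hO1] with M hM
        exact (psi_step hc0 A hgood (A * M) hM).2
    _ = ENNReal.ofReal (1 + c) * ∫⁻ M, ENNReal.ofReal (frobSq ((1 - projM (A * M)) * A)) ∂lam :=
        lintegral_const_mul _ (by fun_prop)
    _ ≤ ENNReal.ofReal (1 + c) * (ENNReal.ofReal C * ENNReal.ofReal (frobSq (A - Aq))) := by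
        gcongr
    _ = ENNReal.ofReal ((1 + c) * (C * frobSq (A - Aq))) := by
        rw [ENNReal.ofReal_mul (p := 1 + c) (by linarith), ENNReal.ofReal_mul (p := C) hC0]
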